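/- arXiv:1111.1162 — 4 statements merged into one kernel-verified Lean document; each statement's English description precedes it below -/
import Mathlib

section
/- (Theorem 2, reliability bound) Fix λ > 0 and assume n ≥ 1. Then ∫ ( (SURE(y) − SE(y)) / (nσ²) )² dP(y) ≤ 6/n + 4‖μ‖₂²/(n²σ²); in particular this normalized expected squared error is O(1/n). -/
open MeasureTheory ProbabilityTheory

/-- The Lasso objective `F_{y,λ}(x) = (1/2)‖y − Ax‖₂² + λ‖x‖₁`, where the design matrix
`A` has columns `a i`, so `(A x) j = ∑ i, x i * a i j`. -/
noncomputable def lassoObjPi {n p : ℕ} (a : Fin p → Fin n → ℝ) (lam : ℝ)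
    (y : Fin n → ℝ) (x : Fin p → ℝ) : ℝ :=
  (1 / 2) * ∑ j, (y j - ∑ i, x i * a i j) ^ 2 + lam * ∑ i, |x i|

/-- A Lasso solution at `(y, λ)` is a global minimizer of the Lasso objective. -/
def IsLassoSolPi {n p : ℕ} (a : Fin p → Fin n → ℝ) (lam : ℝ)
    (y : Fin n → ℝ) (x : Fin p → ℝ) : Prop :=
  ∀ x' : Fin p → ℝ, lassoObjPi a lam y x ≤ lassoObjPi a lam y x'

namespace LassoSure
open scoped NNReal ENNReal

variable {n : ℕ}

noncomputable def gP (μ : Fin n → ℝ) (v : ℝ≥0) : Measure (Fin n → ℝ) :=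
  Measure.pi fun j => gaussianReal (μ j) v

instance (μ : Fin n → ℝ) (v : ℝ≥0) : IsProbabilityMeasure (gP μ v) := by
  unfold gP; infer_instance

noncomputable def rho (μ : Fin n → ℝ) (v : ℝ≥0) (y : Fin n → ℝ) : ℝ :=
  ∏ j, gaussianPDFReal (μ j) v (y j)

lemma rho_nonneg (μ : Fin n → ℝ) (v : ℝ≥0) (y : Fin n → ℝ) : 0 ≤ rho μ v y :=
  Finset.prod_nonneg fun _ _ => gaussianPDFReal_nonneg _ _ _

lemma measurable_rho (μ : Fin n → ℝ) (v : ℝ≥0) : Measurable (rho μ v) := by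
  unfold rho
  exact Finset.measurable_prod _ fun j _ =>
    (measurable_gaussianPDFReal _ _).comp (measurable_pi_apply j)

lemma gP_eq (μ : Fin n → ℝ) {v : ℝ≥0} (hv : v ≠ 0) :
    gP μ v = volume.withDensity (fun y => ENNReal.ofReal (rho μ v y)) := by
  unfold gP
  refine Measure.pi_eq fun s hs => ?_
  rw [withDensity_apply _ (MeasurableSet.univ_pi hs), volume_pi, Measure.restrict_pi_pi]
  have hint : Integrable (rho μ v) (Measure.pi fun i => (volume : Measure ℝ).restrict (s i)) := by
    unfold rho
    exact Integrable.fintype_prod (f := fun j x => gaussianPDFReal (μ j) v x)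
      fun j => (integrable_gaussianPDFReal (μ j) v).restrict
  rw [← ofReal_integral_eq_lintegral_ofReal hint (Filter.Eventually.of_forall (rho_nonneg μ v))]
  unfold rho
  rw [integral_fintype_prod_eq_prod (fun j x => gaussianPDFReal (μ j) v x),
    ENNReal.ofReal_prod_of_nonneg]
  · exact Finset.prod_congr rfl fun j _ => (gaussianReal_apply_eq_integral _ hv _).symm
  · intro j _
    exact integral_nonneg fun x => gaussianPDFReal_nonneg _ _ _

lemma integral_gP (μ : Fin n → ℝ) {v : ℝ≥0} (hv : v ≠ 0) (g : (Fin n → ℝ) → ℝ) :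
    ∫ y, g y ∂(gP μ v) = ∫ y, rho μ v y * g y := by
  rw [gP_eq μ hv, integral_withDensity_eq_integral_toReal_smul (measurable_rho μ v).ennreal_ofReal
    (Filter.Eventually.of_forall fun _ => ENNReal.ofReal_lt_top)]
  refine integral_congr_ae (Filter.Eventually.of_forall fun y => ?_)
  simp [ENNReal.toReal_ofReal (rho_nonneg μ v y)]

lemma integrable_gP (μ : Fin n → ℝ) {v : ℝ≥0} (hv : v ≠ 0) {g : (Fin n → ℝ) → ℝ} :
    Integrable g (gP μ v) ↔ Integrable (fun y => rho μ v y * g y) := by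
  rw [gP_eq μ hv, integrable_withDensity_iff_integrable_smul' (measurable_rho μ v).ennreal_ofReal
    (Filter.Eventually.of_forall fun _ => ENNReal.ofReal_lt_top)]
  simp only [ENNReal.toReal_ofReal (rho_nonneg μ v _), smul_eq_mul]

lemma gP_ac (μ : Fin n → ℝ) {v : ℝ≥0} (hv : v ≠ 0) : gP μ v ≪ volume := by
  rw [gP_eq μ hv]; exact withDensity_absolutelyContinuous _ _

lemma rho_lineDeriv (μ : Fin n → ℝ) {v : ℝ≥0} (hv : v ≠ 0) (j : Fin n) (y : Fin n → ℝ) :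
    HasLineDerivAt ℝ (rho μ v) (-((y j - μ j) / v) * rho μ v y) y (Pi.single j 1) := by
  have hv' : (v : ℝ) ≠ 0 := by exact_mod_cast hv
  have key : ∀ z, rho μ v z = (∏ _j : Fin n, (√(2 * Real.pi * v))⁻¹) *
      Real.exp (∑ i, -(z i - μ i) ^ 2 / (2 * v)) := by
    intro z
    simp only [rho, gaussianPDFReal_def, Finset.prod_mul_distrib, Real.exp_sum]
  unfold HasLineDerivAt
  simp only [key]
  have h1 : HasDerivAt (fun t : ℝ => ∑ i, -((y + t • (Pi.single j (1:ℝ) : Fin n → ℝ)) i - μ i) ^ 2 / (2 * (v:ℝ)))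
      (∑ i, -(2 * (y i - μ i) * (Pi.single j (1:ℝ) : Fin n → ℝ) i) / (2 * v)) 0 := by
    refine HasDerivAt.fun_sum fun i _ => ?_
    have : HasDerivAt (fun t : ℝ => (y + t • (Pi.single j (1:ℝ) : Fin n → ℝ)) i - μ i)
        ((Pi.single j (1:ℝ) : Fin n → ℝ) i) 0 := by
      have := ((hasDerivAt_id (0:ℝ)).mul_const ((Pi.single j (1:ℝ) : Fin n → ℝ) i)).const_add (y i)
      simpa using this.sub_const (μ i)
    have := ((this.pow 2).neg).div_const (2 * (v:ℝ))
    simpa using this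
  have h2 := (h1.exp).const_mul (∏ _j : Fin n, (√(2 * Real.pi * (v:ℝ)))⁻¹)
  refine h2.congr_deriv ?_
  have : (∑ i, -(2 * (y i - μ i) * (Pi.single j (1:ℝ) : Fin n → ℝ) i) / (2 * (v:ℝ)))
      = -((y j - μ j) / v) := by
    rw [Finset.sum_eq_single j]
    · simp; field_simp
    · intro b _ hb; simp [hb]
    · simp
  rw [this]; simp; ring

lemma stein (μ : Fin n → ℝ) {v : ℝ≥0} (hv : v ≠ 0) (j : Fin n) {g g' : (Fin n → ℝ) → ℝ}
    (hg : ∀ y, HasLineDerivAt ℝ g (g' y) y (Pi.single j 1))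
    (h1 : Integrable g (gP μ v)) (h2 : Integrable g' (gP μ v))
    (h3 : Integrable (fun y => (y j - μ j) * g y) (gP μ v)) :
    ∫ y, (y j - μ j) * g y ∂(gP μ v) = v * ∫ y, g' y ∂(gP μ v) := by
  have hv' : (v : ℝ) ≠ 0 := by exact_mod_cast hv
  rw [integral_gP μ hv, integral_gP μ hv]
  rw [integrable_gP μ hv] at h1 h2 h3
  have := integral_bilinear_hasLineDerivAt_right_eq_neg_left_of_integrable
    (f := rho μ v) (f' := fun y => -((y j - μ j) / v) * rho μ v y) (g := g) (g' := g')
    (v := Pi.single j 1) (B := ContinuousLinearMap.mul ℝ ℝ) (μ := volume)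
    (by
      have := h3.const_mul (-(v:ℝ)⁻¹)
      refine this.congr (Filter.Eventually.of_forall fun y => ?_)
      simp; ring) (by simpa using h2) (by simpa using h1)
    (fun y _ => rho_lineDeriv μ hv j y) (fun y _ => hg y)
  simp only [ContinuousLinearMap.mul_apply'] at this
  rw [this, ← integral_neg, ← integral_const_mul]
  refine integral_congr_ae (Filter.Eventually.of_forall fun y => ?_)
  simp; field_simp

lemma integrable_pow_gP (μ : Fin n → ℝ) (v : ℝ≥0) (k : ℕ) :
    Integrable (fun y : Fin n → ℝ => (1 + ‖y‖) ^ k) (gP μ v) := by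
  have hm : MemLp (fun y : Fin n → ℝ => 1 + ∑ j, |y j|) k (gP μ v) := by
    refine (memLp_const (1:ℝ)).add (memLp_finsetSum _ fun j _ => ?_)
    have h := (memLp_id_gaussianReal' (μ := μ j) (v := v) k (by simp)).comp_measurePreserving
      (measurePreserving_eval (fun j => gaussianReal (μ j) v) j)
    exact h.norm
  have := hm.integrable_norm_pow'
  refine this.mono' (by fun_prop) (Filter.Eventually.of_forall fun y => ?_)
  have h0 : ‖y‖ ≤ ∑ j, |y j| := by
    rw [pi_norm_le_iff_of_nonneg (Finset.sum_nonneg fun _ _ => abs_nonneg _)]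
    intro i
    exact Finset.single_le_sum (f := fun j => |y j|) (fun _ _ => abs_nonneg _) (Finset.mem_univ i)
  have h1 : 0 ≤ ‖y‖ := norm_nonneg y
  rw [Real.norm_of_nonneg (by positivity), Real.norm_of_nonneg (by positivity)]
  gcongr

lemma integrable_of_bound (μ : Fin n → ℝ) (v : ℝ≥0) {g : (Fin n → ℝ) → ℝ} (hg : Continuous g)
    {C : ℝ} {k : ℕ} (h : ∀ y, |g y| ≤ C * (1 + ‖y‖) ^ k) : Integrable g (gP μ v) :=
  ((integrable_pow_gP μ v k).const_mul C).mono' hg.aestronglyMeasurable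
    (Filter.Eventually.of_forall h)

end LassoSure

namespace LassoSure
open scoped NNReal ENNReal ContDiff

variable {n : ℕ}

def PG (g : (Fin n → ℝ) → ℝ) : Prop :=
  Continuous g ∧ ∃ (C : ℝ) (k : ℕ), ∀ y, |g y| ≤ C * (1 + ‖y‖) ^ k

lemma PG.integrable {g : (Fin n → ℝ) → ℝ} (hg : PG g) (μ : Fin n → ℝ) (v : ℝ≥0) :
    Integrable g (gP μ v) := by
  obtain ⟨h1, C, k, h⟩ := hg
  exact integrable_of_bound μ v h1 h

lemma PG.mul {f g : (Fin n → ℝ) → ℝ} (hf : PG f) (hg : PG g) : PG (fun y => f y * g y) := by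
  obtain ⟨f1, C, k, hf⟩ := hf
  obtain ⟨g1, D, l, hg⟩ := hg
  refine ⟨f1.mul g1, C * D, k + l, fun y => ?_⟩
  rw [abs_mul, pow_add]
  calc |f y| * |g y| ≤ (C * (1 + ‖y‖) ^ k) * (D * (1 + ‖y‖) ^ l) :=
        mul_le_mul (hf y) (hg y) (abs_nonneg _) ((abs_nonneg _).trans (hf y))
    _ = _ := by ring

lemma PG.add {f g : (Fin n → ℝ) → ℝ} (hf : PG f) (hg : PG g) : PG (fun y => f y + g y) := by
  obtain ⟨f1, C, k, hf⟩ := hf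
  obtain ⟨g1, D, l, hg⟩ := hg
  refine ⟨f1.add g1, |C| + |D|, k + l, fun y => ?_⟩
  have h1 : 1 ≤ 1 + ‖y‖ := by linarith [norm_nonneg y]
  have hk : (1 + ‖y‖) ^ k ≤ (1 + ‖y‖) ^ (k + l) := pow_le_pow_right₀ h1 (by omega)
  have hl : (1 + ‖y‖) ^ l ≤ (1 + ‖y‖) ^ (k + l) := pow_le_pow_right₀ h1 (by omega)
  have hk0 : 0 ≤ (1 + ‖y‖) ^ k := by positivity
  have hl0 : 0 ≤ (1 + ‖y‖) ^ l := by positivity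
  calc |f y + g y| ≤ |f y| + |g y| := abs_add_le _ _
    _ ≤ |C| * (1 + ‖y‖) ^ k + |D| * (1 + ‖y‖) ^ l :=
      add_le_add ((hf y).trans (mul_le_mul_of_nonneg_right (le_abs_self C) hk0))
        ((hg y).trans (mul_le_mul_of_nonneg_right (le_abs_self D) hl0))
    _ ≤ |C| * (1 + ‖y‖) ^ (k + l) + |D| * (1 + ‖y‖) ^ (k + l) := by gcongr
    _ = _ := by ring

lemma PG.const (c : ℝ) : PG (fun _ : Fin n → ℝ => c) :=
  ⟨continuous_const, |c|, 0, fun y => by simp⟩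

lemma PG.sub {f g : (Fin n → ℝ) → ℝ} (hf : PG f) (hg : PG g) : PG (fun y => f y - g y) := by
  have := hf.add ((PG.const (-1)).mul hg)
  simpa [sub_eq_add_neg] using this

lemma PG.sum {ι : Type*} (s : Finset ι) {f : ι → (Fin n → ℝ) → ℝ} (hf : ∀ i, PG (f i)) :
    PG (fun y => ∑ i ∈ s, f i y) := by
  classical
  induction s using Finset.induction_on with
  | empty => simpa using PG.const 0
  | insert a s ha ih => simpa [Finset.sum_insert ha] using (hf a).add ih

lemma PG.coord (μ : Fin n → ℝ) (j : Fin n) : PG (fun y => y j - μ j) := by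
  refine PG.sub ⟨by fun_prop, 1, 1, fun y => ?_⟩ (PG.const _)
  have := norm_le_pi_norm y j
  rw [Real.norm_eq_abs] at this
  linarith

lemma hl_mul {f g : (Fin n → ℝ) → ℝ} {f' g' : ℝ} {y w : Fin n → ℝ}
    (hf : HasLineDerivAt ℝ f f' y w) (hg : HasLineDerivAt ℝ g g' y w) :
    HasLineDerivAt ℝ (fun y => f y * g y) (f' * g y + f y * g') y w := by
  have := HasDerivAt.fun_mul hf hg
  simpa [HasLineDerivAt] using this

lemma hl_sub {f g : (Fin n → ℝ) → ℝ} {f' g' : ℝ} {y w : Fin n → ℝ}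
    (hf : HasLineDerivAt ℝ f f' y w) (hg : HasLineDerivAt ℝ g g' y w) :
    HasLineDerivAt ℝ (fun y => f y - g y) (f' - g') y w :=
  HasDerivAt.fun_sub hf hg

lemma hl_sum {f : Fin n → (Fin n → ℝ) → ℝ} {f' : Fin n → ℝ} {y w : Fin n → ℝ}
    (hf : ∀ i, HasLineDerivAt ℝ (f i) (f' i) y w) :
    HasLineDerivAt ℝ (fun y => ∑ i, f i y) (∑ i, f' i) y w :=
  HasDerivAt.fun_sum fun i _ => hf i

lemma hl_coord (μ : Fin n → ℝ) (i : Fin n) (y w : Fin n → ℝ) :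
    HasLineDerivAt ℝ (fun y => y i - μ i) (w i) y w := by
  have := (((hasDerivAt_id (0:ℝ)).mul_const (w i)).const_add (y i)).sub_const (μ i)
  simpa [HasLineDerivAt] using this

noncomputable def pd (j : Fin n) (g : (Fin n → ℝ) → ℝ) (y : Fin n → ℝ) : ℝ :=
  fderiv ℝ g y (Pi.single j 1)

lemma contDiff_pd (j : Fin n) {g : (Fin n → ℝ) → ℝ} (hg : ContDiff ℝ ∞ g) :
    ContDiff ℝ ∞ (pd j g) := by
  unfold pd
  exact (hg.fderiv_right (m := ∞) (by simp)).clm_apply contDiff_const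

lemma hl_pd (j : Fin n) {g : (Fin n → ℝ) → ℝ} (hg : ContDiff ℝ ∞ g) (y : Fin n → ℝ) :
    HasLineDerivAt ℝ g (pd j g y) y (Pi.single j 1) :=
  ((hg.differentiable (by simp)) y).hasFDerivAt.hasLineDerivAt _

lemma pd_comm (i j : Fin n) {g : (Fin n → ℝ) → ℝ} (hg : ContDiff ℝ ∞ g) (y : Fin n → ℝ) :
    pd i (pd j g) y = pd j (pd i g) y := by
  have hs : IsSymmSndFDerivAt ℝ g y :=
    (hg.contDiffAt (x := y)).isSymmSndFDerivAt (by simpa using WithTop.coe_le_coe.2 (le_top : (2:ℕ∞) ≤ ⊤))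
  have hd : DifferentiableAt ℝ (fderiv ℝ g) y :=
    ((hg.fderiv_right (m := ∞) (by simp)).differentiable (by simp)) y
  have key : ∀ a b : Fin n, pd a (pd b g) y
      = fderiv ℝ (fderiv ℝ g) y (Pi.single a 1) (Pi.single b 1) := by
    intro a b
    unfold pd
    rw [fderiv_clm_apply hd (by fun_prop)]
    simp
  rw [key, key]
  exact hs.eq _ _

/-- second order Stein identity, smooth case -/
lemma second_order (μ : Fin n → ℝ) {v : ℝ≥0} (hv : v ≠ 0) (h : Fin n → (Fin n → ℝ) → ℝ)
    (hs : ∀ i, ContDiff ℝ ∞ (h i)) (b0 : ∀ i, PG (h i)) (b1 : ∀ i j, PG (pd j (h i)))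
    (b2 : ∀ i j k, PG (pd k (pd j (h i)))) :
    ∫ y, (∑ i, ((y i - μ i) * h i y - v * pd i (h i) y)) ^ 2 ∂(gP μ v)
      = v * ∫ y, ∑ i, (h i y) ^ 2 ∂(gP μ v)
        + v ^ 2 * ∫ y, ∑ i, ∑ j, pd j (h i) y * pd i (h j) y ∂(gP μ v) := by
  set D : (Fin n → ℝ) → ℝ := fun y => ∑ i, ((y i - μ i) * h i y - v * pd i (h i) y) with hD
  set R : Fin n → Fin n → (Fin n → ℝ) → ℝ :=
    fun i j y => (y j - μ j) * pd i (h j) y - v * pd i (pd j (h j)) y with hR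
  have pR : ∀ i j, PG (R i j) := fun i j =>
    ((PG.coord μ j).mul (b1 j i)).sub ((PG.const _).mul (b2 j j i))
  have pD : PG D := PG.sum _ fun i => ((PG.coord μ i).mul (b0 i)).sub ((PG.const _).mul (b1 i i))
  set DD : Fin n → (Fin n → ℝ) → ℝ := fun i y => h i y + ∑ j, R i j y with hDD
  have pDD : ∀ i, PG (DD i) := fun i => (b0 i).add (PG.sum _ fun j => pR i j)
  have dD : ∀ i y, HasLineDerivAt ℝ D (DD i y) y (Pi.single i 1) := by
    intro i y
    have hconst : ∀ y, HasLineDerivAt ℝ (fun _ : Fin n → ℝ => (v:ℝ)) 0 y (Pi.single i 1) :=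
      fun y => hasDerivAt_const _ _
    have := hl_sum (fun j => hl_sub (hl_mul (hl_coord μ j y (Pi.single i 1)) (hl_pd i (hs j) y))
      (hl_mul (hconst y) (hl_pd i (contDiff_pd j (hs j)) y)))
    have e : DD i y = ∑ j, ((Pi.single i (1:ℝ) : Fin n → ℝ) j * h j y + (y j - μ j) * pd i (h j) y
        - (0 * pd j (h j) y + v * pd i (pd j (h j)) y)) := by
      simp only [hDD, hR, zero_mul, zero_add, add_sub_assoc]
      rw [Finset.sum_add_distrib]
      congr 1
      simp [Pi.single_apply]
    rw [e]; exact this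
  -- first step
  have s1 : ∀ i, ∫ y, (y i - μ i) * (h i y * D y) ∂(gP μ v)
      = v * ∫ y, (pd i (h i) y * D y + h i y * DD i y) ∂(gP μ v) := fun i =>
    stein μ hv i (fun y => hl_mul (hl_pd i (hs i) y) (dD i y))
      (((b0 i).mul pD).integrable μ v)
      ((((b1 i i).mul pD).add ((b0 i).mul (pDD i))).integrable μ v)
      (((PG.coord μ i).mul ((b0 i).mul pD)).integrable μ v)
  have s2 : ∀ i j, ∫ y, (y j - μ j) * (h i y * pd i (h j) y) ∂(gP μ v)
      = v * ∫ y, (pd j (h i) y * pd i (h j) y + h i y * pd j (pd i (h j)) y) ∂(gP μ v) := fun i j =>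
    stein μ hv j (fun y => hl_mul (hl_pd j (hs i) y) (hl_pd j (contDiff_pd i (hs j)) y))
      (((b0 i).mul (b1 j i)).integrable μ v)
      ((((b1 i j).mul (b1 j i)).add ((b0 i).mul (b2 j i j))).integrable μ v)
      (((PG.coord μ j).mul ((b0 i).mul (b1 j i))).integrable μ v)
  have s3 : ∀ i j, ∫ y, h i y * R i j y ∂(gP μ v) = v * ∫ y, pd j (h i) y * pd i (h j) y ∂(gP μ v) := by
    intro i j
    have e : ∀ y, h i y * R i j y = (y j - μ j) * (h i y * pd i (h j) y)
        - v * (h i y * pd j (pd i (h j)) y) := by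
      intro y; simp only [hR]; rw [pd_comm i j (hs j)]; ring
    simp only [e]
    rw [integral_sub (((PG.coord μ j).mul ((b0 i).mul (b1 j i))).integrable μ v)
      (((PG.const _).mul ((b0 i).mul (b2 j i j))).integrable μ v), s2, integral_const_mul,
      integral_add (((b1 i j).mul (b1 j i)).integrable μ v)
        (((b0 i).mul (b2 j i j)).integrable μ v)]
    ring
  have s4 : ∀ i, ∫ y, ((y i - μ i) * h i y - v * pd i (h i) y) * D y ∂(gP μ v)
      = v * ∫ y, (h i y) ^ 2 ∂(gP μ v) + ∑ j, v ^ 2 * ∫ y, pd j (h i) y * pd i (h j) y ∂(gP μ v) := by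
    intro i
    have e : ∀ y, ((y i - μ i) * h i y - v * pd i (h i) y) * D y
        = (y i - μ i) * (h i y * D y) - v * (pd i (h i) y * D y) := by intro y; ring
    simp only [e]
    rw [integral_sub (((PG.coord μ i).mul ((b0 i).mul pD)).integrable μ v)
      (((PG.const _).mul ((b1 i i).mul pD)).integrable μ v), s1, integral_const_mul,
      integral_add (((b1 i i).mul pD).integrable μ v)
        (((b0 i).mul (pDD i)).integrable μ v)]
    have e2 : ∀ y, h i y * DD i y = (h i y) ^ 2 + ∑ j, h i y * R i j y := by
      intro y; simp only [hDD]; rw [mul_add, Finset.mul_sum]; ring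
    simp only [e2]
    have hsq : PG (fun y => (h i y) ^ 2) := by
      simpa [pow_two] using (b0 i).mul (b0 i)
    rw [integral_add (hsq.integrable μ v)
      ((PG.sum _ fun j => (b0 i).mul (pR i j)).integrable μ v),
      integral_finsetSum _ (fun j _ => ((b0 i).mul (pR i j)).integrable μ v)]
    simp only [s3]
    rw [← Finset.mul_sum, ← Finset.mul_sum]
    ring
  have e : ∀ y, D y ^ 2 = ∑ i, ((y i - μ i) * h i y - v * pd i (h i) y) * D y := by
    intro y; rw [← Finset.sum_mul, pow_two]
  have hsq : ∀ i, PG (fun y => (h i y) ^ 2) := fun i => by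
    simpa [pow_two] using (b0 i).mul (b0 i)
  calc ∫ y, D y ^ 2 ∂(gP μ v) = ∫ y, ∑ i, ((y i - μ i) * h i y - v * pd i (h i) y) * D y ∂(gP μ v) := by
        simp only [e]
    _ = _ := by
      rw [integral_finsetSum _ (fun i _ => ((((PG.coord μ i).mul (b0 i)).sub
        ((PG.const _).mul (b1 i i))).mul pD).integrable μ v)]
      simp only [s4]
      rw [integral_finsetSum _ (fun i _ => (hsq i).integrable μ v),
        integral_finsetSum _ (fun i _ => (PG.sum _ fun j =>
          (b1 i j).mul (b1 j i)).integrable μ v), Finset.mul_sum, Finset.mul_sum,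
        ← Finset.sum_add_distrib]
      refine Finset.sum_congr rfl fun i _ => ?_
      rw [integral_finsetSum _ (fun j _ => ((b1 i j).mul (b1 j i)).integrable μ v),
        Finset.mul_sum]

end LassoSure

namespace LassoSure
open scoped NNReal ENNReal ContDiff Convolution Topology

variable {n : ℕ}

noncomputable def cv (h ψ : (Fin n → ℝ) → ℝ) : (Fin n → ℝ) → ℝ :=
  h ⋆[ContinuousLinearMap.mul ℝ ℝ, volume] ψ

lemma cv_eq (h ψ : (Fin n → ℝ) → ℝ) (y : Fin n → ℝ) : cv h ψ y = ∫ t, h (y - t) * ψ t := by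
  unfold cv
  rw [convolution_eq_swap]
  rfl

lemma cv_int {h ψ : (Fin n → ℝ) → ℝ} (hh : Continuous h) (h1 : Continuous ψ)
    (h2 : HasCompactSupport ψ) (y : Fin n → ℝ) : Integrable (fun t => h (y - t) * ψ t) :=
  Continuous.integrable_of_hasCompactSupport (by fun_prop) h2.mul_left

lemma cv_lip {h ψ : (Fin n → ℝ) → ℝ} {K : ℝ≥0} (hh : LipschitzWith K h) (h1 : Continuous ψ)
    (h2 : HasCompactSupport ψ) :
    LipschitzWith (K * (∫ t, |ψ t|).toNNReal) (cv h ψ) := by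
  refine LipschitzWith.of_dist_le_mul fun x y => ?_
  rw [NNReal.coe_mul, Real.coe_toNNReal _ (integral_nonneg fun _ => abs_nonneg _), Real.dist_eq,
    cv_eq, cv_eq, ← integral_sub (cv_int hh.continuous h1 h2 x) (cv_int hh.continuous h1 h2 y)]
  have hi : Integrable ψ := h1.integrable_of_hasCompactSupport h2
  have hb : ∀ t, ‖h (x - t) * ψ t - h (y - t) * ψ t‖ ≤ K * dist x y * |ψ t| := by
    intro t
    rw [← sub_mul, norm_mul, Real.norm_eq_abs (ψ t)]
    gcongr
    have := hh.dist_le_mul (x - t) (y - t)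
    rwa [dist_sub_right, dist_eq_norm] at this
  have := norm_integral_le_of_norm_le (hi.abs.const_mul (K * dist x y))
    (Filter.Eventually.of_forall hb)
  rw [integral_const_mul] at this
  rw [Real.norm_eq_abs] at this
  linarith

lemma cv_contDiff {h ψ : (Fin n → ℝ) → ℝ} (hh : Continuous h) (h1 : ContDiff ℝ ∞ ψ)
    (h2 : HasCompactSupport ψ) : ContDiff ℝ ∞ (cv h ψ) :=
  h2.contDiff_convolution_right _ hh.locallyIntegrable h1

lemma cv_pd {h ψ : (Fin n → ℝ) → ℝ} (hh : Continuous h) (h1 : ContDiff ℝ ∞ ψ)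
    (h2 : HasCompactSupport ψ) (j : Fin n) : pd j (cv h ψ) = cv h (pd j ψ) := by
  ext y
  have h1' : ContDiff ℝ 1 ψ := h1.of_le (by exact_mod_cast le_top)
  have := h2.hasFDerivAt_convolution_right (ContinuousLinearMap.mul ℝ ℝ) (μ := volume)
    hh.locallyIntegrable h1' y
  unfold pd cv
  rw [this.fderiv, convolution_precompR_apply _ hh.locallyIntegrable (h2.fderiv ℝ)
    (h1'.continuous_fderiv one_ne_zero)]

lemma pd_bound {g : (Fin n → ℝ) → ℝ} {K : ℝ≥0} (hg : LipschitzWith K g) (j : Fin n)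
    (y : Fin n → ℝ) : |pd j g y| ≤ K := by
  unfold pd
  have h1 := (fderiv ℝ g y).le_opNorm (Pi.single j 1)
  have h2 := norm_fderiv_le_of_lipschitz ℝ hg (x₀ := y)
  have h3 : ‖(Pi.single j (1:ℝ) : Fin n → ℝ)‖ ≤ 1 := by
    rw [pi_norm_le_iff_of_nonneg zero_le_one]
    intro i
    rw [Pi.single_apply]
    split_ifs <;> simp
  refine h1.trans ((mul_le_mul_of_nonneg_left h3 (norm_nonneg _)).trans ?_)
  rwa [mul_one]

lemma pd_PG {g : (Fin n → ℝ) → ℝ} {K : ℝ≥0} (hs : ContDiff ℝ ∞ g) (hg : LipschitzWith K g)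
    (j : Fin n) : PG (pd j g) :=
  ⟨(contDiff_pd j hs).continuous, K, 0, fun y => by simpa using pd_bound hg j y⟩

lemma lip_growth {g : (Fin n → ℝ) → ℝ} {K : ℝ≥0} (hg : LipschitzWith K g) (y : Fin n → ℝ) :
    |g y| ≤ (|g 0| + K) * (1 + ‖y‖) := by
  have := hg.dist_le_mul y 0
  rw [Real.dist_eq, dist_zero_right] at this
  have h2 : |g y| ≤ |g y - g 0| + |g 0| := by
    have := abs_add_le (g y - g 0) (g 0); simpa using this
  nlinarith [norm_nonneg y, abs_nonneg (g 0), K.coe_nonneg,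
    mul_nonneg (abs_nonneg (g 0)) (norm_nonneg y)]

lemma lip_PG {g : (Fin n → ℝ) → ℝ} {K : ℝ≥0} (hg : LipschitzWith K g) : PG g :=
  ⟨hg.continuous, |g 0| + K, 1, fun y => by simpa using lip_growth hg y⟩

noncomputable def bump (n k : ℕ) : ContDiffBump (0 : Fin n → ℝ) where
  rIn := 1 / (2 * ((k : ℝ) + 1))
  rOut := 1 / ((k : ℝ) + 1)
  rIn_pos := by positivity
  rIn_lt_rOut := by
    apply one_div_lt_one_div_of_lt <;> nlinarith [Nat.cast_nonneg (α := ℝ) k]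

noncomputable def bn (n k : ℕ) : (Fin n → ℝ) → ℝ := (bump n k).normed volume

lemma bn_contDiff (n k : ℕ) : ContDiff ℝ ∞ (bn n k) := (bump n k).contDiff_normed
lemma bn_cs (n k : ℕ) : HasCompactSupport (bn n k) := (bump n k).hasCompactSupport_normed
lemma bn_cont (n k : ℕ) : Continuous (bn n k) := (bump n k).continuous_normed
lemma bn_nonneg (n k : ℕ) (y) : 0 ≤ bn n k y := (bump n k).nonneg_normed y
lemma bn_int (n k : ℕ) : ∫ y, bn n k y = 1 := (bump n k).integral_normed
lemma bn_supp (n k : ℕ) (y) (h : bn n k y ≠ 0) : ‖y‖ < 1 / ((k : ℝ) + 1) := by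
  have : y ∈ Function.support (bn n k) := h
  rw [bn, ContDiffBump.support_normed_eq, mem_ball_zero_iff] at this
  exact this

lemma moll_lip {h : (Fin n → ℝ) → ℝ} {K : ℝ≥0} (hh : LipschitzWith K h) (k : ℕ) :
    LipschitzWith K (cv h (bn n k)) := by
  have := cv_lip hh (bn_cont n k) (bn_cs n k)
  simpa [abs_of_nonneg (bn_nonneg n k _), bn_int] using this

lemma moll_close {h : (Fin n → ℝ) → ℝ} {K : ℝ≥0} (hh : LipschitzWith K h) (k : ℕ)
    (y : Fin n → ℝ) : |cv h (bn n k) y - h y| ≤ K * (1 / ((k : ℝ) + 1)) := by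
  have hi : Integrable (bn n k) := (bn_cont n k).integrable_of_hasCompactSupport (bn_cs n k)
  have e : cv h (bn n k) y - h y = ∫ t, (h (y - t) * bn n k t - h y * bn n k t) := by
    rw [integral_sub (cv_int hh.continuous (bn_cont n k) (bn_cs n k) y) (hi.const_mul _),
      integral_const_mul, bn_int, cv_eq, mul_one]
  rw [e, ← Real.norm_eq_abs]
  have hb : ∀ t, ‖h (y - t) * bn n k t - h y * bn n k t‖ ≤ K * (1 / ((k : ℝ) + 1)) * bn n k t := by
    intro t
    by_cases ht : bn n k t = 0
    · simp [ht]
    · rw [← sub_mul, norm_mul, Real.norm_of_nonneg (bn_nonneg n k t)]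
      have := hh.dist_le_mul (y - t) y
      rw [dist_eq_norm, dist_eq_norm] at this
      have h3 := bn_supp n k t ht
      refine mul_le_mul_of_nonneg_right (this.trans ?_) (bn_nonneg n k t)
      refine mul_le_mul_of_nonneg_left ?_ K.coe_nonneg
      simpa using h3.le
  have := norm_integral_le_of_norm_le (hi.const_mul (K * (1 / ((k : ℝ) + 1))))
    (Filter.Eventually.of_forall hb)
  rwa [integral_const_mul, bn_int, mul_one] at this

lemma moll_affine {h : (Fin n → ℝ) → ℝ} (k : ℕ)
    (y : Fin n → ℝ) (ℓ : (Fin n → ℝ) →L[ℝ] ℝ) {r : ℝ}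
    (hr : ∀ z, ‖z - y‖ < r → h z = h y + ℓ (z - y)) (hk : 1 / ((k : ℝ) + 1) < r) (j : Fin n) :
    pd j (cv h (bn n k)) y = ℓ (Pi.single j 1) := by
  have hi : Integrable (bn n k) := (bn_cont n k).integrable_of_hasCompactSupport (bn_cs n k)
  have ev : ∀ᶠ z in 𝓝 y, cv h (bn n k) z = (h y + ℓ (z - y)) - ∫ t, ℓ t * bn n k t := by
    filter_upwards [Metric.ball_mem_nhds y (sub_pos.2 hk)] with z hz
    rw [mem_ball_iff_norm] at hz
    have hi2 : Integrable (fun t => ℓ t * bn n k t) :=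
      Continuous.integrable_of_hasCompactSupport
        (ℓ.continuous.mul (bn_cont n k)) (bn_cs n k).mul_left
    have e : ∀ t, h (z - t) * bn n k t = (h y + ℓ (z - y)) * bn n k t - ℓ t * bn n k t := by
      intro t
      by_cases ht : bn n k t = 0
      · simp [ht]
      · have h3 := bn_supp n k t ht
        rw [hr (z - t)]
        · have : z - t - y = (z - y) - t := by abel
          rw [this, map_sub ℓ (z - y) t]; ring
        · have : z - t - y = (z - y) - t := by abel
          rw [this]
          have := norm_sub_le (z - y) t
          linarith
    rw [cv_eq]
    simp only [e]
    rw [integral_sub (hi.const_mul _) hi2, integral_const_mul, bn_int, mul_one]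
  have hd : HasFDerivAt (fun z => (h y + ℓ (z - y)) - ∫ t, ℓ t * bn n k t) ℓ y := by
    have := (ℓ.hasFDerivAt (x := y)).const_add (h y - ℓ y - ∫ t, ℓ t * bn n k t)
    refine this.congr_of_eventuallyEq (Filter.Eventually.of_forall fun z => ?_)
    simp only [map_sub]
    ring
  unfold pd
  rw [(hd.congr_of_eventuallyEq ev).fderiv]

lemma second_order_lip (μ : Fin n → ℝ) {v : ℝ≥0} (hv : v ≠ 0) (h : Fin n → (Fin n → ℝ) → ℝ)
    {K : ℝ≥0} (hl : ∀ i, LipschitzWith K (h i))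
    (ℓ : Fin n → (Fin n → ℝ) → ((Fin n → ℝ) →L[ℝ] ℝ))
    (hloc : ∀ᵐ y ∂(gP μ v), ∀ i, ∀ᶠ z in 𝓝 y, h i z = h i y + ℓ i y (z - y)) :
    ∫ y, (∑ i, ((y i - μ i) * h i y - v * ℓ i y (Pi.single i 1))) ^ 2 ∂(gP μ v)
      = v * ∫ y, ∑ i, (h i y) ^ 2 ∂(gP μ v)
        + v ^ 2 * ∫ y, ∑ i, ∑ j, ℓ i y (Pi.single j 1) * ℓ j y (Pi.single i 1) ∂(gP μ v) := by
  set H : ℕ → Fin n → (Fin n → ℝ) → ℝ := fun k i => cv (h i) (bn n k) with hH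
  have Hs : ∀ k i, ContDiff ℝ ∞ (H k i) := fun k i =>
    cv_contDiff (hl i).continuous (bn_contDiff n k) (bn_cs n k)
  have Hl : ∀ k i, LipschitzWith K (H k i) := fun k i => moll_lip (hl i) k
  have b0 : ∀ k i, PG (H k i) := fun k i => lip_PG (Hl k i)
  have b1 : ∀ k i j, PG (pd j (H k i)) := fun k i j => pd_PG (Hs k i) (Hl k i) j
  have b2 : ∀ k i j l, PG (pd l (pd j (H k i))) := by
    intro k i j l
    have hcs : HasCompactSupport (pd j (bn n k)) := by
      unfold pd
      exact ((bn_cs n k).fderiv ℝ).comp_left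
        (g := fun T : (Fin n → ℝ) →L[ℝ] ℝ => T (Pi.single j 1)) (by simp)
    refine pd_PG (contDiff_pd j (Hs k i))
      (K := K * (∫ t, |pd j (bn n k) t|).toNNReal) ?_ l
    simp only [hH]
    rw [cv_pd (hl i).continuous (bn_contDiff n k) (bn_cs n k)]
    exact cv_lip (hl i) (contDiff_pd j (bn_contDiff n k)).continuous hcs
  have ident := fun k => second_order μ hv (H k) (Hs k) (b0 k) (b1 k) (b2 k)
  have t0 : ∀ i y, Filter.Tendsto (fun k => H k i y) Filter.atTop (𝓝 (h i y)) := by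
    intro i y
    rw [tendsto_iff_dist_tendsto_zero]
    refine squeeze_zero (fun _ => dist_nonneg) (fun k => moll_close (hl i) k y) ?_
    simpa using (tendsto_one_div_add_atTop_nhds_zero_nat (𝕜 := ℝ)).const_mul (K:ℝ)
  have t1 : ∀ᵐ y ∂(gP μ v), ∀ i j, Filter.Tendsto (fun k => pd j (H k i) y) Filter.atTop
      (𝓝 (ℓ i y (Pi.single j 1))) := by
    filter_upwards [hloc] with y hy i j
    obtain ⟨r, hr, hr2⟩ := Metric.eventually_nhds_iff.1 (hy i)
    have : ∀ᶠ k : ℕ in Filter.atTop, 1 / ((k:ℝ) + 1) < r :=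
      (tendsto_one_div_add_atTop_nhds_zero_nat (𝕜 := ℝ)).eventually_lt_const hr
    refine tendsto_const_nhds.congr' ?_
    filter_upwards [this] with k hk
    exact (moll_affine k y (ℓ i y) (fun z hz => hr2 (by rwa [dist_eq_norm])) hk j).symm
  set C : ℝ := ∑ i, |h i 0| + 2 * K with hC
  have hC0 : 0 ≤ C := by positivity
  have g0 : ∀ k i y, |H k i y| ≤ C * (1 + ‖y‖) := by
    intro k i y
    have h1 := moll_close (hl i) k y
    have h2 := lip_growth (hl i) y
    have h3 : |h i 0| ≤ ∑ i, |h i 0| :=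
      Finset.single_le_sum (f := fun i => |h i 0|) (fun _ _ => abs_nonneg _) (Finset.mem_univ i)
    have h4 : |H k i y| ≤ |H k i y - h i y| + |h i y| := by
      have := abs_add_le (H k i y - h i y) (h i y); simpa using this
    have h5 : 1 / ((k:ℝ) + 1) ≤ 1 := by
      rw [div_le_one (by positivity)]; linarith [Nat.cast_nonneg (α := ℝ) k]
    have h6 : (K:ℝ) * (1 / ((k:ℝ) + 1)) ≤ K * (1 + ‖y‖) :=
      mul_le_mul_of_nonneg_left (by linarith [norm_nonneg y]) K.coe_nonneg
    have h7 : (|h i 0| + K) * (1 + ‖y‖) ≤ (∑ i, |h i 0| + K) * (1 + ‖y‖) := by gcongr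
    calc |H k i y| ≤ K * (1 + ‖y‖) + (∑ i, |h i 0| + K) * (1 + ‖y‖) := by linarith
      _ = _ := by rw [hC]; ring
  have g1 : ∀ k i j y, |pd j (H k i) y| ≤ K := fun k i j y => pd_bound (Hl k i) j y
  have hv0 : (0:ℝ) ≤ v := v.coe_nonneg
  have hK0 : (0:ℝ) ≤ K := K.coe_nonneg
  have L1 : Filter.Tendsto (fun k => ∫ y, (∑ i, ((y i - μ i) * H k i y - v * pd i (H k i) y)) ^ 2
      ∂(gP μ v)) Filter.atTop
      (𝓝 (∫ y, (∑ i, ((y i - μ i) * h i y - v * ℓ i y (Pi.single i 1))) ^ 2 ∂(gP μ v))) := by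
    set M : ℝ := ∑ _i : Fin n, ((1 + ‖μ‖) * C + v * K) with hM
    refine tendsto_integral_of_dominated_convergence (fun y => M ^ 2 * (1 + ‖y‖) ^ 4) ?_
      ((integrable_pow_gP μ v 4).const_mul _) ?_ ?_
    · intro k
      have : PG (fun y => ∑ i, ((y i - μ i) * H k i y - v * pd i (H k i) y)) :=
        PG.sum _ fun i => ((PG.coord μ i).mul (b0 k i)).sub ((PG.const _).mul (b1 k i i))
      exact (this.1.pow 2).aestronglyMeasurable
    · intro k
      refine Filter.Eventually.of_forall fun y => ?_
      have h1 : 1 ≤ 1 + ‖y‖ := by linarith [norm_nonneg y]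
      have hb : |∑ i, ((y i - μ i) * H k i y - v * pd i (H k i) y)| ≤ M * (1 + ‖y‖) ^ 2 := by
        refine (Finset.abs_sum_le_sum_abs _ _).trans ?_
        rw [hM, Finset.sum_mul]
        refine Finset.sum_le_sum fun i _ => ?_
        have e1 : |y i - μ i| ≤ (1 + ‖μ‖) * (1 + ‖y‖) := by
          have a1 := norm_le_pi_norm y i
          have a2 := norm_le_pi_norm μ i
          have a3 := norm_sub_le (y i) (μ i)
          rw [Real.norm_eq_abs (y i - μ i)] at a3
          nlinarith [norm_nonneg y, norm_nonneg μ, mul_nonneg (norm_nonneg y) (norm_nonneg μ)]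
        calc |(y i - μ i) * H k i y - v * pd i (H k i) y|
            ≤ |(y i - μ i) * H k i y| + |v * pd i (H k i) y| := abs_sub _ _
          _ = |y i - μ i| * |H k i y| + v * |pd i (H k i) y| := by
              rw [abs_mul, abs_mul, abs_of_nonneg hv0]
          _ ≤ ((1 + ‖μ‖) * (1 + ‖y‖)) * (C * (1 + ‖y‖)) + v * K := by
              gcongr
              · exact g0 k i y
              · exact g1 k i i y
          _ ≤ ((1 + ‖μ‖) * (1 + ‖y‖)) * (C * (1 + ‖y‖)) + v * K * (1 + ‖y‖) ^ 2 := by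
              have : v * (K:ℝ) * 1 ≤ v * K * (1 + ‖y‖) ^ 2 :=
                mul_le_mul_of_nonneg_left (one_le_pow₀ h1) (by positivity)
              linarith
          _ = _ := by ring
      rw [norm_pow, Real.norm_eq_abs]
      calc _ ≤ (M * (1 + ‖y‖) ^ 2) ^ 2 := pow_le_pow_left₀ (abs_nonneg _) hb 2
        _ = _ := by ring
    · filter_upwards [t1] with y hy
      exact (tendsto_finsetSum _ fun i _ =>
        ((t0 i y).const_mul _).sub ((hy i i).const_mul _)).pow 2
  have L2 : Filter.Tendsto (fun k => ∫ y, ∑ i, (H k i y) ^ 2 ∂(gP μ v)) Filter.atTop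
      (𝓝 (∫ y, ∑ i, (h i y) ^ 2 ∂(gP μ v))) := by
    refine tendsto_integral_of_dominated_convergence
      (fun y => (∑ _i : Fin n, C ^ 2) * (1 + ‖y‖) ^ 2) ?_
      ((integrable_pow_gP μ v 2).const_mul _) ?_ ?_
    · intro k
      exact (continuous_finsetSum _ fun i _ => (b0 k i).1.pow 2).aestronglyMeasurable
    · intro k
      refine Filter.Eventually.of_forall fun y => ?_
      rw [Real.norm_of_nonneg (Finset.sum_nonneg fun _ _ => sq_nonneg _), Finset.sum_mul]
      refine Finset.sum_le_sum fun i _ => ?_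
      rw [← mul_pow, ← sq_abs]
      exact pow_le_pow_left₀ (abs_nonneg _) (g0 k i y) 2
    · exact Filter.Eventually.of_forall fun y =>
        tendsto_finsetSum _ fun i _ => (t0 i y).pow 2
  have L3 : Filter.Tendsto (fun k => ∫ y, ∑ i, ∑ j, pd j (H k i) y * pd i (H k j) y ∂(gP μ v))
      Filter.atTop
      (𝓝 (∫ y, ∑ i, ∑ j, ℓ i y (Pi.single j 1) * ℓ j y (Pi.single i 1) ∂(gP μ v))) := by
    refine tendsto_integral_of_dominated_convergence
      (fun y => (∑ _i : Fin n, ∑ _j : Fin n, (K:ℝ) * K)) ?_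
      (integrable_const _) ?_ ?_
    · intro k
      exact (continuous_finsetSum _ fun i _ => continuous_finsetSum _ fun j _ =>
        (b1 k i j).1.mul (b1 k j i).1).aestronglyMeasurable
    · intro k
      refine Filter.Eventually.of_forall fun y => ?_
      refine norm_sum_le_of_le _ fun i _ => norm_sum_le_of_le _ fun j _ => ?_
      rw [norm_mul]
      exact mul_le_mul (g1 k i j y) (g1 k j i y) (norm_nonneg _) hK0
    · filter_upwards [t1] with y hy
      exact tendsto_finsetSum _ fun i _ => tendsto_finsetSum _ fun j _ =>
        (hy i j).mul (hy j i)
  refine tendsto_nhds_unique L1 ?_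
  simp only [ident]
  exact (L2.const_mul _).add (L3.const_mul _)

end LassoSure

namespace LassoSure
open scoped NNReal ENNReal Topology

variable {n p : ℕ}

def fit (a : Fin p → Fin n → ℝ) (x : Fin p → ℝ) : Fin n → ℝ := fun j => ∑ i, x i * a i j

lemma fit_eq (a : Fin p → Fin n → ℝ) (x : Fin p → ℝ) : fit a x = ∑ i, x i • a i := by
  ext j; simp [fit, Finset.sum_apply]

lemma fit_add (a : Fin p → Fin n → ℝ) (x x' : Fin p → ℝ) :
    fit a (x + x') = fit a x + fit a x' := by
  simp [fit_eq, add_smul, Finset.sum_add_distrib]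

lemma fit_sub (a : Fin p → Fin n → ℝ) (x x' : Fin p → ℝ) :
    fit a (x - x') = fit a x - fit a x' := by
  simp [fit_eq, sub_smul, Finset.sum_sub_distrib]

lemma fit_smul (a : Fin p → Fin n → ℝ) (t : ℝ) (x : Fin p → ℝ) :
    fit a (t • x) = t • fit a x := by
  simp [fit_eq, mul_smul, Finset.smul_sum]

lemma fit_dot (a : Fin p → Fin n → ℝ) (x : Fin p → ℝ) (r : Fin n → ℝ) :
    fit a x ⬝ᵥ r = ∑ i, x i * (a i ⬝ᵥ r) := by
  rw [fit_eq, sum_dotProduct]; simp [smul_dotProduct]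

lemma obj_eq (a : Fin p → Fin n → ℝ) (lam : ℝ) (y : Fin n → ℝ) (x : Fin p → ℝ) :
    lassoObjPi a lam y x = (1 / 2) * ((y - fit a x) ⬝ᵥ (y - fit a x)) + lam * ∑ i, |x i| := by
  simp [lassoObjPi, fit, dotProduct, pow_two]

def KKT (a : Fin p → Fin n → ℝ) (lam : ℝ) (y : Fin n → ℝ) (x : Fin p → ℝ) : Prop :=
  ∀ i, |a i ⬝ᵥ (y - fit a x)| ≤ lam ∧ x i * (a i ⬝ᵥ (y - fit a x)) = lam * |x i|

lemma dot_self_nonneg (u : Fin n → ℝ) : 0 ≤ u ⬝ᵥ u :=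
  Finset.sum_nonneg fun _ _ => mul_self_nonneg _

lemma kkt_sum {a : Fin p → Fin n → ℝ} {lam : ℝ} {y : Fin n → ℝ} {x : Fin p → ℝ}
    (h : KKT a lam y x) (w : Fin p → ℝ) :
    fit a w ⬝ᵥ (y - fit a x) ≤ lam * ∑ i, |w i| := by
  rw [fit_dot, Finset.mul_sum]
  refine Finset.sum_le_sum fun i _ => ?_
  calc w i * (a i ⬝ᵥ (y - fit a x)) ≤ |w i| * |a i ⬝ᵥ (y - fit a x)| := by
        rw [← abs_mul]; exact le_abs_self _
    _ ≤ |w i| * lam := mul_le_mul_of_nonneg_left (h i).1 (abs_nonneg _)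
    _ = _ := mul_comm _ _

lemma kkt_eq {a : Fin p → Fin n → ℝ} {lam : ℝ} {y : Fin n → ℝ} {x : Fin p → ℝ}
    (h : KKT a lam y x) : fit a x ⬝ᵥ (y - fit a x) = lam * ∑ i, |x i| := by
  rw [fit_dot, Finset.mul_sum]
  exact Finset.sum_congr rfl fun i _ => (h i).2

lemma kkt_sol {a : Fin p → Fin n → ℝ} {lam : ℝ} {y : Fin n → ℝ} {x : Fin p → ℝ}
    (h : KKT a lam y x) : IsLassoSolPi a lam y x := by
  intro w
  rw [obj_eq, obj_eq]
  have h1 := kkt_sum h w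
  have h2 := kkt_eq h
  have h3 := dot_self_nonneg (fit a w - fit a x)
  have e : y - fit a w = (y - fit a x) - (fit a w - fit a x) := by abel
  rw [e]
  set r := y - fit a x
  simp only [sub_dotProduct, dotProduct_sub] at *
  rw [dotProduct_comm r (fit a w), dotProduct_comm r (fit a x)]
  linarith

lemma sol_kkt {a : Fin p → Fin n → ℝ} {lam : ℝ} (hlam : 0 < lam) {y : Fin n → ℝ} {x : Fin p → ℝ}
    (h : IsLassoSolPi a lam y x) : KKT a lam y x := by
  set r := y - fit a x with hr
  have key : ∀ w : Fin p → ℝ, fit a w ⬝ᵥ r - lam * ∑ i, |w i|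
      ≤ fit a x ⬝ᵥ r - lam * ∑ i, |x i| := by
    intro w
    set d := fit a w - fit a x with hd
    have hq := dot_self_nonneg d
    have hineq : ∀ t : ℝ, 0 < t → t ≤ 1 →
        d ⬝ᵥ r ≤ lam * (∑ i, |w i| - ∑ i, |x i|) + t / 2 * (d ⬝ᵥ d) := by
      intro t ht ht1
      have := h (x + t • (w - x))
      rw [obj_eq, obj_eq, fit_add, fit_smul, fit_sub, ← hd] at this
      have e : y - (fit a x + t • d) = r - t • d := by rw [hr]; abel
      rw [e, ← hr] at this
      simp only [sub_dotProduct, dotProduct_sub, smul_dotProduct, dotProduct_smul,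
        smul_eq_mul] at this
      rw [dotProduct_comm r d] at this
      have habs : ∑ i, |(x + t • (w - x)) i| ≤ (1 - t) * ∑ i, |x i| + t * ∑ i, |w i| := by
        rw [Finset.mul_sum, Finset.mul_sum, ← Finset.sum_add_distrib]
        refine Finset.sum_le_sum fun i _ => ?_
        have e2 : (x + t • (w - x)) i = (1 - t) * x i + t * w i := by
          simp only [Pi.add_apply, Pi.smul_apply, Pi.sub_apply, smul_eq_mul]; ring
        rw [e2]
        refine (abs_add_le _ _).trans ?_
        rw [abs_mul, abs_mul, abs_of_nonneg (by linarith : (0:ℝ) ≤ 1 - t), abs_of_pos ht]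
      have h4 := mul_le_mul_of_nonneg_left habs hlam.le
      have h5 : t * (d ⬝ᵥ r) ≤
          t * (lam * (∑ i, |w i| - ∑ i, |x i|) + t / 2 * (d ⬝ᵥ d)) := by
        nlinarith
      exact le_of_mul_le_mul_left h5 ht
    have hlim : d ⬝ᵥ r ≤ lam * (∑ i, |w i| - ∑ i, |x i|) := by
      refine le_of_forall_pos_le_add fun ε hε => ?_
      have hq1 : 0 < d ⬝ᵥ d + 1 := by linarith
      set t := min 1 (ε / (d ⬝ᵥ d + 1)) with ht
      have ht0 : 0 < t := lt_min one_pos (by positivity)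
      have := hineq t ht0 (min_le_left _ _)
      have h6 : t * (d ⬝ᵥ d + 1) ≤ ε := by
        have := min_le_right 1 (ε / (d ⬝ᵥ d + 1))
        rwa [le_div_iff₀ hq1] at this
      nlinarith [mul_nonneg ht0.le hq]
    rw [hd, sub_dotProduct] at hlim
    linarith
  have hz : fit a x ⬝ᵥ r - lam * ∑ i, |x i| = 0 := by
    apply le_antisymm
    · have := key (2 • x)
      have e1 : fit a (2 • x) = fit a x + fit a x := by rw [two_smul, fit_add]
      have e2 : ∑ i, |(2 • x) i| = 2 * ∑ i, |x i| := by
        rw [Finset.mul_sum]; refine Finset.sum_congr rfl fun i _ => ?_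
        simp [abs_mul]
      rw [e1, e2, add_dotProduct] at this
      linarith
    · have := key 0
      simpa [fit_eq] using this
  rw [hz] at key
  have hsingle : ∀ i t, t * (a i ⬝ᵥ r) ≤ lam * |t| := by
    intro i t
    have := key (Pi.single i t)
    rw [fit_dot] at this
    rw [Finset.sum_eq_single i (by intro b _ hb; simp [hb]) (by simp),
      Finset.sum_eq_single i (by intro b _ hb; simp [hb]) (by simp)] at this
    simp only [Pi.single_eq_same] at this
    linarith
  rw [fit_dot, Finset.mul_sum, ← Finset.sum_sub_distrib] at hz
  have hz2 := (Finset.sum_eq_zero_iff_of_nonpos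
    (fun i _ => by linarith [hsingle i (x i)])).1 hz
  intro i
  refine ⟨?_, by linarith [hz2 i (Finset.mem_univ i)]⟩
  rw [abs_le]
  constructor
  · have := hsingle i (-1); simp at this; linarith
  · have := hsingle i 1; simp at this; linarith

/-- firm nonexpansiveness -/
lemma firm {a : Fin p → Fin n → ℝ} {lam : ℝ} {y y' : Fin n → ℝ} {x x' : Fin p → ℝ}
    (h : KKT a lam y x) (h' : KKT a lam y' x') :
    (fit a x - fit a x') ⬝ᵥ (fit a x - fit a x') ≤ (fit a x - fit a x') ⬝ᵥ (y - y') := by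
  have h1 := kkt_sum h x'
  have h2 := kkt_sum h' x
  have h3 := kkt_eq h
  have h4 := kkt_eq h'
  have : 0 ≤ (fit a x - fit a x') ⬝ᵥ ((y - fit a x) - (y' - fit a x')) := by
    rw [dotProduct_sub, sub_dotProduct, sub_dotProduct]; linarith
  have e : (y - fit a x) - (y' - fit a x') = (y - y') - (fit a x - fit a x') := by abel
  rw [e, dotProduct_sub] at this
  linarith

lemma fit_unique {a : Fin p → Fin n → ℝ} {lam : ℝ} {y : Fin n → ℝ} {x x' : Fin p → ℝ}
    (h : KKT a lam y x) (h' : KKT a lam y x') : fit a x = fit a x' := by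
  have h1 := firm h h'
  rw [sub_self, dotProduct_zero] at h1
  have := le_antisymm h1 (dot_self_nonneg _)
  exact sub_eq_zero.1 (dotProduct_self_eq_zero.1 this)

lemma exists_fit {a : Fin p → Fin n → ℝ} {S : Finset (Fin p)} {w : Fin n → ℝ}
    (hw : w ∈ Submodule.span ℝ (a '' S)) : ∃ c : Fin p → ℝ, (∀ i ∉ S, c i = 0) ∧ fit a c = w := by
  induction hw using Submodule.span_induction with
  | mem w hw =>
    obtain ⟨i, hi, rfl⟩ := hw
    refine ⟨Pi.single i 1, fun j hj => ?_, ?_⟩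
    · have : j ≠ i := fun h => hj (h ▸ hi)
      simp [this]
    · rw [fit_eq, Finset.sum_eq_single i (by intro b _ hb; simp [hb]) (by simp)]; simp
  | zero => exact ⟨0, fun _ _ => rfl, by simp [fit_eq]⟩
  | add u w _ _ hu hw =>
    obtain ⟨c, hc, rfl⟩ := hu
    obtain ⟨d, hd, rfl⟩ := hw
    exact ⟨c + d, fun i hi => by simp [hc i hi, hd i hi], fit_add _ _ _⟩
  | smul t w _ hw =>
    obtain ⟨c, hc, rfl⟩ := hw
    exact ⟨t • c, fun i hi => by simp [hc i hi], fit_smul _ _ _⟩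

lemma exists_proj (a : Fin p → Fin n → ℝ) (S : Finset (Fin p)) :
    ∃ Q : (Fin n → ℝ) →ₗ[ℝ] (Fin n → ℝ), (∀ u w, Q u ⬝ᵥ w = u ⬝ᵥ Q w) ∧
      LinearMap.IsProj (Submodule.span ℝ (a '' S)) Q := by
  set e := WithLp.linearEquiv 2 ℝ (Fin n → ℝ) with he
  set U : Submodule ℝ (EuclideanSpace ℝ (Fin n)) :=
    (Submodule.span ℝ (a '' S)).comap (e : EuclideanSpace ℝ (Fin n) →ₗ[ℝ] (Fin n → ℝ)) with hU
  refine ⟨(e : EuclideanSpace ℝ (Fin n) →ₗ[ℝ] (Fin n → ℝ)) ∘ₗ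
    (U.starProjection : EuclideanSpace ℝ (Fin n) →ₗ[ℝ] EuclideanSpace ℝ (Fin n)) ∘ₗ
    (e.symm : (Fin n → ℝ) →ₗ[ℝ] EuclideanSpace ℝ (Fin n)), ?_, ?_, ?_⟩
  · intro u w
    have hin : ∀ u w : EuclideanSpace ℝ (Fin n), e u ⬝ᵥ e w = inner ℝ u w := by
      intro u w
      simp [he, PiLp.inner_apply, dotProduct, mul_comm]
    have := Submodule.inner_starProjection_left_eq_right U (e.symm u) (e.symm w)
    rw [← hin, ← hin] at this
    simpa using this
  · intro w
    have : U.starProjection (e.symm w) ∈ U := Submodule.starProjection_apply_mem _ _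
    exact this
  · intro w hw
    have : e.symm w ∈ U := by simpa [hU] using hw
    simp [Submodule.starProjection_eq_self_iff.2 this]

lemma exists_lift (a : Fin p → Fin n → ℝ) (S : Finset (Fin p)) :
    ∃ (Q : (Fin n → ℝ) →ₗ[ℝ] (Fin n → ℝ)) (G : (Fin n → ℝ) →ₗ[ℝ] (Fin p → ℝ)),
      (∀ u w, Q u ⬝ᵥ w = u ⬝ᵥ Q w) ∧
      LinearMap.IsProj (Submodule.span ℝ (a '' S)) Q ∧
      (∀ w, fit a (G w) = Q w) ∧ (∀ w, ∀ i ∉ S, G w i = 0) := by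
  obtain ⟨Q, hs, hp⟩ := exists_proj a S
  have := fun j : Fin n => exists_fit (hp.map_mem (Pi.single j 1))
  choose c hc hc2 using this
  refine ⟨Q, (Fintype.linearCombination ℝ c), hs, hp, ?_, ?_⟩
  · intro w
    rw [Fintype.linearCombination_apply]
    have h1 : w = ∑ j, w j • (Pi.single j 1 : Fin n → ℝ) := by
      ext k; simp [Finset.sum_apply, Pi.single_apply]
    conv_rhs => rw [h1, map_sum]
    have h2 : ∀ s : Finset (Fin n), fit a (∑ j ∈ s, w j • c j) = ∑ j ∈ s, w j • fit a (c j) := by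
      intro s
      induction s using Finset.induction_on with
      | empty => simp [fit_eq]
      | insert k s hk ih => rw [Finset.sum_insert hk, fit_add, fit_smul, ih, Finset.sum_insert hk]
    rw [h2]
    refine Finset.sum_congr rfl fun j _ => ?_
    rw [hc2, map_smul]
  · intro w i hi
    rw [Fintype.linearCombination_apply, Finset.sum_apply]
    exact Finset.sum_eq_zero fun j _ => by simp [hc j i hi]

end LassoSure

namespace LassoSure
open scoped NNReal ENNReal Topology

variable {n p : ℕ}

lemma keep_sign {x w κ lam : ℝ} (hx : x ≠ 0) (h : x * κ = lam * |x|) (hw : 0 ≤ x * w) :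
    w * κ = lam * |w| := by
  rcases lt_or_gt_of_ne hx with h0 | h0
  · have hw' : w ≤ 0 := by
      by_contra hc; push Not at hc; nlinarith [mul_pos (neg_pos.2 h0) hc]
    have : κ = -lam := by
      rw [abs_of_neg h0] at h
      have : x * κ = x * (-lam) := by linarith
      exact mul_left_cancel₀ hx this
    rw [abs_of_nonpos hw', this]; ring
  · have hw' : 0 ≤ w := by
      by_contra hc; push Not at hc; nlinarith [mul_pos h0 (neg_pos.2 hc)]
    have : κ = lam := by
      rw [abs_of_pos h0] at h
      have : x * κ = x * lam := by linarith
      exact mul_left_cancel₀ hx this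
    rw [abs_of_nonneg hw', this]; ring

lemma min_supp_indep {a : Fin p → Fin n → ℝ} {lam : ℝ} {y : Fin n → ℝ}
    {x : Fin p → ℝ} (h : KKT a lam y x) {S : Finset (Fin p)} (hS : ∀ i, i ∈ S ↔ x i ≠ 0)
    (hmin : ∀ x', KKT a lam y x' → S.card ≤ {i | x' i ≠ 0}.ncard) : LinearIndepOn ℝ a S := by
  classical
  rw [linearIndepOn_finset_iff]
  by_contra hcon
  push Not at hcon
  obtain ⟨c0, hc0, i0, hi0, hne⟩ := hcon
  set c : Fin p → ℝ := fun i => if i ∈ S then c0 i else 0 with hc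
  have hfit : fit a c = 0 := by
    rw [fit_eq, ← hc0]
    rw [← Finset.sum_subset (Finset.subset_univ S)]
    · exact Finset.sum_congr rfl fun i hi => by simp [hc, hi]
    · intro i _ hi; simp [hc, hi]
  set T := S.filter (fun i => c0 i ≠ 0) with hT
  have hTne : T.Nonempty := ⟨i0, by simp [hT, hi0, hne]⟩
  obtain ⟨k, hk, hkmin⟩ := T.exists_min_image (fun i => |x i / c0 i|) hTne
  have hkS : k ∈ S := (Finset.mem_filter.1 hk).1
  have hkc : c0 k ≠ 0 := (Finset.mem_filter.1 hk).2
  set t := x k / c0 k with ht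
  have hle : ∀ i ∈ S, |t * c i| ≤ |x i| := by
    intro i hi
    by_cases h0 : c0 i = 0
    · simp [hc, h0]
    · have := hkmin i (by simp [hT, hi, h0])
      simp only [hc, hi, if_true, abs_mul]
      simp only [abs_div] at this
      rw [le_div_iff₀ (abs_pos.2 h0)] at this
      exact this
  set x' : Fin p → ℝ := x - t • c with hx'
  have hfit' : fit a x' = fit a x := by rw [hx', fit_sub, fit_smul, hfit]; simp
  have hk' : KKT a lam y x' := by
    intro i
    rw [hfit']
    refine ⟨(h i).1, ?_⟩
    by_cases hi : i ∈ S
    · refine keep_sign ((hS i).1 hi) (h i).2 ?_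
      have h1 := hle i hi
      have h2 : x' i = x i - t * c i := by simp [hx']
      have h3 : x i * (t * c i) ≤ |x i| * |x i| := by
        calc x i * (t * c i) ≤ |x i * (t * c i)| := le_abs_self _
          _ = |x i| * |t * c i| := abs_mul _ _
          _ ≤ _ := mul_le_mul_of_nonneg_left h1 (abs_nonneg _)
      rw [abs_mul_abs_self] at h3
      rw [h2]; linarith
    · have h1 : x i = 0 := by by_contra h0; exact hi ((hS i).2 h0)
      simp [hx', hc, hi, h1]
  have hsub : {i | x' i ≠ 0} ⊆ ((S.erase k : Finset (Fin p)) : Set (Fin p)) := by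
    intro i hi
    simp only [Set.mem_setOf_eq] at hi
    have hiS : i ∈ S := by
      by_contra hiS
      have h1 : x i = 0 := by by_contra h0; exact hiS ((hS i).2 h0)
      exact hi (by simp [hx', hc, hiS, h1])
    have hik : i ≠ k := by
      rintro rfl
      apply hi
      simp only [hx', Pi.sub_apply, Pi.smul_apply, smul_eq_mul, hc, hkS, if_true, ht]
      field_simp; ring
    simp [hiS, hik]
  have h1 := Set.ncard_le_ncard hsub (Finset.finite_toSet _)
  rw [Set.ncard_coe_finset, Finset.card_erase_of_mem hkS] at h1
  have h2 := hmin x' hk'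
  have h3 : 0 < S.card := Finset.card_pos.2 ⟨k, hkS⟩
  omega

lemma hyperplane_null (u : Fin n → ℝ) (hu : u ≠ 0) (c d : ℝ) :
    volume {y : Fin n → ℝ | |u ⬝ᵥ y + c| = d} = 0 := by
  have key : ∀ b : ℝ, volume {y : Fin n → ℝ | u ⬝ᵥ y = b} = 0 := by
    intro b
    set ℓ : (Fin n → ℝ) →ₗ[ℝ] ℝ := dotProductBilin ℝ ℝ u with hℓ
    have hl : ∀ y, ℓ y = u ⬝ᵥ y := fun y => rfl
    have huu : u ⬝ᵥ u ≠ 0 := fun h => hu (dotProduct_self_eq_zero.1 h)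
    set A : AffineSubspace ℝ (Fin n → ℝ) :=
      AffineSubspace.mk' ((b / (u ⬝ᵥ u)) • u) (LinearMap.ker ℓ) with hA
    have hmem : ∀ y, y ∈ A ↔ u ⬝ᵥ y = b := by
      intro y
      rw [hA, AffineSubspace.mem_mk', LinearMap.mem_ker, vsub_eq_sub, map_sub, hl, map_smul, hl,
        smul_eq_mul, div_mul_cancel₀ _ huu, sub_eq_zero]
    have hset : {y : Fin n → ℝ | u ⬝ᵥ y = b} = (A : Set (Fin n → ℝ)) := by
      ext y; exact (hmem y).symm
    rw [hset]
    refine Measure.addHaar_affineSubspace _ _ fun htop => ?_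
    have h1 : ((b + 1) / (u ⬝ᵥ u)) • u ∈ A := by rw [htop]; trivial
    rw [hmem, dotProduct_smul, smul_eq_mul, div_mul_cancel₀ _ huu] at h1
    linarith
  refine measure_mono_null (t := {y | u ⬝ᵥ y = d - c} ∪ {y | u ⬝ᵥ y = -d - c}) ?_
    (measure_union_null (key _) (key _))
  intro y hy
  simp only [Set.mem_setOf_eq] at hy
  rcases abs_choice (u ⬝ᵥ y + c) with h | h
  · left; simp only [Set.mem_setOf_eq]; linarith
  · right; simp only [Set.mem_setOf_eq]; linarith

lemma local_affine (a : Fin p → Fin n → ℝ) (lam : ℝ) (hlam : 0 < lam)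
    (f : (Fin n → ℝ) → Fin n → ℝ)
    (hf : ∀ z, ∃ x : Fin p → ℝ, IsLassoSolPi a lam z x ∧ f z = fun j => ∑ i, x i * a i j)
    (m : (Fin n → ℝ) → ℕ)
    (hm : ∀ z, IsLeast
      {k : ℕ | ∃ x : Fin p → ℝ, IsLassoSolPi a lam z x ∧ {i | x i ≠ 0}.ncard = k} (m z)) :
    ∃ N : Set (Fin n → ℝ), volume N = 0 ∧ ∀ y ∉ N, ∃ Q : Matrix (Fin n) (Fin n) ℝ,
      Q * Q = Q ∧ Q.trace = m y ∧ ∀ᶠ z in 𝓝 y, f z = f y + Q.mulVec (z - y) := by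
  classical
  have hfu : ∀ z x, KKT a lam z x → f z = fit a x := by
    intro z x hx
    obtain ⟨w, hw, hfz⟩ := hf z
    rw [hfz]
    exact fit_unique (sol_kkt hlam hw) hx
  choose Q G hsym hproj hG hG0 using exists_lift a
  refine ⟨⋃ (S : Finset (Fin p)) (s : Fin p → SignType) (i : Fin p)
    (_ : a i - Q S (a i) ≠ 0),
    {y | |(a i - Q S (a i)) ⬝ᵥ y + ∑ j, G S (a i) j * (lam * (s j : ℝ))| = lam}, ?_, ?_⟩
  · simp only [measure_iUnion_null_iff]
    intro S s i hi
    exact hyperplane_null _ hi _ _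
  intro y hy
  obtain ⟨⟨x, hxs, hxm⟩, hleast⟩ := hm y
  have hx := sol_kkt hlam hxs
  set S : Finset (Fin p) := Finset.univ.filter (fun i => x i ≠ 0) with hSdef
  have hS : ∀ i, i ∈ S ↔ x i ≠ 0 := fun i => by simp [hSdef]
  have hcard : S.card = m y := by
    rw [← hxm, ← Set.ncard_coe_finset]; congr 1; ext i; simp [hSdef]
  have hind : LinearIndepOn ℝ a S := by
    refine min_supp_indep hx hS fun x' hx' => ?_
    rw [hcard]
    exact hleast ⟨x', kkt_sol hx', rfl⟩
  have hfix : ∀ i ∈ S, Q S (a i) = a i := fun i hi =>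
    (hproj S).map_id _ (Submodule.subset_span ⟨i, hi, rfl⟩)
  have hidem : ∀ w, Q S (Q S w) = Q S w := fun w => (hproj S).map_id _ ((hproj S).map_mem w)
  set r := y - fit a x with hr
  -- strictness
  have hstrict : ∀ i, a i - Q S (a i) ≠ 0 → |a i ⬝ᵥ r| < lam := by
    intro i hi
    refine lt_of_le_of_ne (hx i).1 fun heq => hy ?_
    simp only [Set.mem_iUnion]
    refine ⟨S, fun j => SignType.sign (x j), i, hi, ?_⟩
    simp only [Set.mem_setOf_eq]
    refine Eq.trans ?_ heq
    congr 1
    have hfx : Q S (fit a x) = fit a x := by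
      rw [fit_eq, map_sum]
      refine Finset.sum_congr rfl fun j _ => ?_
      rw [map_smul]
      by_cases hj : x j = 0
      · simp [hj]
      · rw [hfix j ((hS j).2 hj)]
    have e1 : (a i - Q S (a i)) ⬝ᵥ y = (a i - Q S (a i)) ⬝ᵥ r := by
      rw [hr, dotProduct_sub, sub_dotProduct _ _ (fit a x), hsym, hfx]; ring
    have e2 : Q S (a i) ⬝ᵥ r = ∑ j, G S (a i) j * (lam * (SignType.sign (x j) : ℝ)) := by
      rw [← hG, fit_dot]
      refine Finset.sum_congr rfl fun j _ => ?_
      by_cases hj : x j = 0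
      · rw [hG0 S (a i) j (fun h => (hS j).1 h hj)]; simp
      · congr 1
        have := (hx j).2
        rw [← hr] at this
        have h2 : x j * (lam * (SignType.sign (x j) : ℝ)) = lam * |x j| := by
          rw [← sign_mul_self]; ring
        exact mul_left_cancel₀ hj (this.trans h2.symm)
    rw [e1, ← e2, sub_dotProduct]; ring
  refine ⟨LinearMap.toMatrix' (Q S), ?_, ?_, ?_⟩
  · rw [← LinearMap.toMatrix'_mul]
    congr 1
    exact LinearMap.ext fun w => by simpa using hidem w
  · have h1 : LinearMap.trace ℝ _ (Q S) = S.card := by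
      rw [(hproj S).trace]
      have : Module.finrank ℝ (Submodule.span ℝ (a '' S)) = S.card := by
        have h2 := finrank_span_set_eq_card (s := a '' (S : Set (Fin p))) hind.id_image
        rw [h2, Set.toFinset_image, Finset.card_image_of_injOn (by simpa using hind.injOn)]
        simp
      rw [this]
    rw [LinearMap.trace_eq_matrix_trace ℝ (Pi.basisFun ℝ (Fin n)),
      LinearMap.toMatrix_eq_toMatrix'] at h1
    rw [h1, hcard]
  · have hcont : Continuous fun z : Fin n → ℝ => G S (z - y) :=
      (LinearMap.continuous_of_finiteDimensional (G S)).comp (continuous_id.sub continuous_const)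
    have ev : ∀ᶠ z in 𝓝 y, ∀ i, (x i ≠ 0 → 0 ≤ x i * (x i + G S (z - y) i)) ∧
        (a i - Q S (a i) ≠ 0 → |a i ⬝ᵥ r + (a i - Q S (a i)) ⬝ᵥ (z - y)| < lam) := by
      rw [Filter.eventually_all]
      intro i
      refine Filter.Eventually.and ?_ ?_
      · by_cases h0 : x i = 0
        · simp [h0]
        · have hc : Continuous fun z => x i * (x i + G S (z - y) i) :=
            continuous_const.mul (continuous_const.add ((continuous_apply i).comp hcont))
          have h1 : 0 < x i * (x i + G S (y - y) i) := by
            simp only [sub_self, map_zero, Pi.zero_apply, add_zero]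
            exact mul_self_pos.2 h0
          filter_upwards [hc.continuousAt.eventually_const_lt h1] with z hz _ using hz.le
      · by_cases h0 : a i - Q S (a i) = 0
        · simp [h0]
        · have hc : Continuous fun z => |a i ⬝ᵥ r + (a i - Q S (a i)) ⬝ᵥ (z - y)| := by
            unfold dotProduct; fun_prop
          have h1 : |a i ⬝ᵥ r + (a i - Q S (a i)) ⬝ᵥ (y - y)| < lam := by
            simpa using hstrict i h0
          filter_upwards [hc.continuousAt.eventually_lt_const h1] with z hz _ using hz
    filter_upwards [ev] with z hz
    have hkz : KKT a lam z (x + G S (z - y)) := by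
      intro i
      have hres : a i ⬝ᵥ (z - fit a (x + G S (z - y)))
          = a i ⬝ᵥ r + (a i - Q S (a i)) ⬝ᵥ (z - y) := by
        rw [fit_add, hG, sub_dotProduct, hsym, hr]
        simp only [dotProduct_sub, dotProduct_add, map_sub]
        ring
      rw [hres]
      have hiz := hz i
      by_cases hu : a i - Q S (a i) = 0
      · rw [hu, zero_dotProduct, add_zero]
        refine ⟨(hx i).1, ?_⟩
        by_cases h0 : x i = 0
        · have : G S (z - y) i = 0 := hG0 S _ i fun h => (hS i).1 h h0
          have e : (x + G S (z - y)) i = 0 := by rw [Pi.add_apply, h0, this, add_zero]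
          rw [e]; simp
        · exact keep_sign h0 (hx i).2 (hiz.1 h0)
      · have hiS : i ∉ S := fun h => hu (by rw [hfix i h, sub_self])
        have h0 : x i = 0 := by by_contra h0; exact hiS ((hS i).2 h0)
        have : G S (z - y) i = 0 := hG0 S _ i hiS
        have e : (x + G S (z - y)) i = 0 := by rw [Pi.add_apply, h0, this, add_zero]
        exact ⟨(hiz.2 hu).le, by rw [e]; simp⟩
    rw [hfu z _ hkz, hfu y _ hx, fit_add, hG, LinearMap.toMatrix'_mulVec]

end LassoSure

namespace LassoSure
open scoped NNReal ENNReal Topology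

variable {n p : ℕ}

lemma int_sq (μ : Fin n → ℝ) {v : ℝ≥0} (hv : v ≠ 0) (j : Fin n) :
    ∫ y, (y j) ^ 2 ∂(gP μ v) = v + μ j ^ 2 := by
  have c := PG.coord μ j
  have i0 := ((PG.const (1:ℝ)).integrable μ v)
  have i1 := c.integrable μ v
  have i2 := (c.mul c).integrable μ v
  have h1 := stein μ hv j (g := fun y => y j - μ j) (g' := fun _ => 1)
    (fun y => by simpa using hl_coord μ j y (Pi.single j 1)) i1 i0 i2
  have h0 := stein μ hv j (g := fun y => 1) (g' := fun _ => 0)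
    (fun y => hasDerivAt_const _ _) i0 ((PG.const (0:ℝ)).integrable μ v) (by simpa using i1)
  simp only [mul_one, integral_zero, mul_zero] at h0
  simp at h1
  have e : ∀ y : Fin n → ℝ, (y j) ^ 2
      = ((y j - μ j) * (y j - μ j) + (2 * μ j) * (y j - μ j)) + μ j ^ 2 := fun y => by ring
  rw [integral_congr_ae (Filter.Eventually.of_forall e)]
  have i3 : Integrable (fun y : Fin n → ℝ => (y j - μ j) * (y j - μ j) + (2 * μ j) * (y j - μ j))
      (gP μ v) := i2.add (i1.const_mul _)
  rw [integral_add i3 (integrable_const _),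
    integral_add i2 (i1.const_mul _), integral_const_mul, h1, h0]
  simp

lemma f_kkt {a : Fin p → Fin n → ℝ} {lam : ℝ} (hlam : 0 < lam)
    {f : (Fin n → ℝ) → Fin n → ℝ}
    (hf : ∀ z, ∃ x : Fin p → ℝ, IsLassoSolPi a lam z x ∧ f z = fun j => ∑ i, x i * a i j)
    (z : Fin n → ℝ) : ∃ x, KKT a lam z x ∧ f z = fit a x := by
  obtain ⟨x, h, e⟩ := hf z
  exact ⟨x, sol_kkt hlam h, e⟩

lemma f_bound {a : Fin p → Fin n → ℝ} {lam : ℝ} (hlam : 0 < lam)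
    {f : (Fin n → ℝ) → Fin n → ℝ}
    (hf : ∀ z, ∃ x : Fin p → ℝ, IsLassoSolPi a lam z x ∧ f z = fun j => ∑ i, x i * a i j)
    (μ y : Fin n → ℝ) :
    ∑ i, (y i + μ i - 2 * f y i) ^ 2 ≤ 2 * ∑ i, (y i) ^ 2 + 2 * ∑ i, (μ i) ^ 2 := by
  obtain ⟨x, hx, e⟩ := f_kkt hlam hf y
  have h1 := kkt_eq hx
  rw [← e] at h1
  have h2 : 0 ≤ f y ⬝ᵥ (y - f y) := by
    rw [h1]; exact mul_nonneg hlam.le (Finset.sum_nonneg fun _ _ => abs_nonneg _)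
  have h3 : ∑ i, (y i + μ i - 2 * f y i) ^ 2
      ≤ ∑ i, (2 * y i ^ 2 + 2 * μ i ^ 2 - 8 * (f y i * (y i - f y i))) :=
    Finset.sum_le_sum fun i _ => by nlinarith [sq_nonneg (y i - 2 * f y i - μ i)]
  rw [Finset.sum_sub_distrib, Finset.sum_add_distrib, ← Finset.mul_sum, ← Finset.mul_sum,
    ← Finset.mul_sum] at h3
  have h4 : f y ⬝ᵥ (y - f y) = ∑ i, f y i * (y i - f y i) := rfl
  linarith

lemma f_lip {a : Fin p → Fin n → ℝ} {lam : ℝ} (hlam : 0 < lam)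
    {f : (Fin n → ℝ) → Fin n → ℝ}
    (hf : ∀ z, ∃ x : Fin p → ℝ, IsLassoSolPi a lam z x ∧ f z = fun j => ∑ i, x i * a i j)
    (y z : Fin n → ℝ) (i : Fin n) : |f y i - f z i| ≤ n * ‖y - z‖ := by
  obtain ⟨x, hx, e⟩ := f_kkt hlam hf y
  obtain ⟨x', hx', e'⟩ := f_kkt hlam hf z
  have h1 := firm hx hx'
  rw [← e, ← e'] at h1
  have hdi : f y i - f z i = (f y - f z) i := rfl
  rw [hdi]
  generalize f y - f z = d at *
  generalize y - z = w at *
  have h2 := dot_self_nonneg (d - w)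
  have h3 : (d - w) ⬝ᵥ (d - w) = d ⬝ᵥ d - 2 * (d ⬝ᵥ w) + w ⬝ᵥ w := by
    rw [sub_dotProduct, dotProduct_sub, dotProduct_sub, dotProduct_comm w d]; ring
  have h4 : d ⬝ᵥ d ≤ w ⬝ᵥ w := by linarith
  have h5 : w ⬝ᵥ w ≤ n * ‖w‖ ^ 2 := by
    have : ∑ j, w j * w j ≤ ∑ _j : Fin n, ‖w‖ ^ 2 := Finset.sum_le_sum fun j _ => by
      have := norm_le_pi_norm w j
      rw [Real.norm_eq_abs] at this
      rw [← abs_mul_abs_self, sq]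
      exact mul_self_le_mul_self (abs_nonneg _) this
    have e6 : w ⬝ᵥ w = ∑ j, w j * w j := rfl
    rw [e6]
    simpa using this
  have h6 : d i * d i ≤ d ⬝ᵥ d :=
    Finset.single_le_sum (f := fun j => d j * d j) (fun j _ => mul_self_nonneg _) (Finset.mem_univ i)
  have hn : (1:ℝ) ≤ n := by
    have := i.pos
    exact_mod_cast this
  refine abs_le_of_sq_le_sq ?_ (by positivity)
  have : (n:ℝ) * ‖w‖ ^ 2 ≤ (n * ‖w‖) ^ 2 := by
    rw [mul_pow, sq (n:ℝ)]
    exact mul_le_mul_of_nonneg_right (by nlinarith) (sq_nonneg _)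
  nlinarith

lemma main_bound {a : Fin p → Fin n → ℝ} {lam : ℝ} (hlam : 0 < lam)
    (μ : Fin n → ℝ) {v : ℝ≥0} (hv : v ≠ 0)
    {f : (Fin n → ℝ) → Fin n → ℝ}
    (hf : ∀ z, ∃ x : Fin p → ℝ, IsLassoSolPi a lam z x ∧ f z = fun j => ∑ i, x i * a i j)
    {m : (Fin n → ℝ) → ℕ}
    (hm : ∀ z, IsLeast
      {k : ℕ | ∃ x : Fin p → ℝ, IsLassoSolPi a lam z x ∧ {i | x i ≠ 0}.ncard = k} (m z)) :
    ∫ y, ((-(n : ℝ) * v + ∑ j, (f y j - y j) ^ 2 + 2 * v * (m y : ℝ))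
        - ∑ j, (f y j - μ j) ^ 2) ^ 2 ∂(gP μ v)
      ≤ 3 * n * (v:ℝ) ^ 2 + 4 * v * ∑ j, (μ j) ^ 2 := by
  classical
  obtain ⟨N, hN, hloc⟩ := local_affine a lam hlam f hf m hm
  choose! Q hQ using hloc
  have hae : ∀ᵐ y ∂(gP μ v), y ∉ N := by
    have := gP_ac μ hv hN
    exact measure_eq_zero_iff_ae_notMem.1 this
  set h : Fin n → (Fin n → ℝ) → ℝ := fun i y => y i + μ i - 2 * f y i with hh
  set ℓ : Fin n → (Fin n → ℝ) → ((Fin n → ℝ) →L[ℝ] ℝ) := fun i y =>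
    LinearMap.toContinuousLinearMap
      ((LinearMap.proj i : (Fin n → ℝ) →ₗ[ℝ] ℝ) ∘ₗ Matrix.toLin' (1 - (2:ℝ) • Q y)) with hl
  have hl_app : ∀ i y w, ℓ i y w = w i - 2 * (Q y).mulVec w i := by
    intro i y w
    simp [hl, Matrix.sub_mulVec, Matrix.smul_mulVec]
  have hl_single : ∀ i y j, ℓ i y (Pi.single j 1) = (1 - (2:ℝ) • Q y : Matrix (Fin n) (Fin n) ℝ) i j := by
    intro i y j
    simp [hl, Matrix.one_apply, Pi.single_apply]
  have hlip : ∀ i, LipschitzWith (1 + 2 * n : ℝ≥0) (h i) := by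
    intro i
    refine LipschitzWith.of_dist_le_mul fun y z => ?_
    have h1 := f_lip hlam hf y z i
    have h2 := norm_le_pi_norm (y - z) i
    rw [Real.norm_eq_abs, Pi.sub_apply] at h2
    rw [Real.dist_eq, dist_eq_norm]
    have e : h i y - h i z = (y i - z i) - 2 * (f y i - f z i) := by simp only [hh]; ring
    rw [e]
    push_cast
    rw [abs_le] at *
    constructor <;> linarith [h1.1, h1.2, h2.1, h2.2]
  have key := second_order_lip μ hv h hlip ℓ (by
    filter_upwards [hae] with y hy i
    filter_upwards [(hQ y hy).2.2] with z hz
    rw [hl_app]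
    simp only [hh, hz, Pi.add_apply, Pi.sub_apply]
    ring)
  have e1 : ∫ y, ((-(n : ℝ) * v + ∑ j, (f y j - y j) ^ 2 + 2 * v * (m y : ℝ))
        - ∑ j, (f y j - μ j) ^ 2) ^ 2 ∂(gP μ v)
      = ∫ y, (∑ i, ((y i - μ i) * h i y - v * ℓ i y (Pi.single i 1))) ^ 2 ∂(gP μ v) := by
    refine integral_congr_ae ?_
    filter_upwards [hae] with y hy
    congr 1
    have t : ∑ i, ℓ i y (Pi.single i 1) = n - 2 * m y := by
      simp_rw [hl_single]
      change Matrix.trace (1 - (2:ℝ) • Q y : Matrix (Fin n) (Fin n) ℝ) = _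
      rw [Matrix.trace_sub, Matrix.trace_smul, (hQ y hy).2.1]
      simp
    rw [Finset.sum_sub_distrib, ← Finset.mul_sum, t]
    have : ∑ i, (y i - μ i) * h i y = ∑ j, (f y j - y j) ^ 2 - ∑ j, (f y j - μ j) ^ 2 := by
      rw [← Finset.sum_sub_distrib]
      exact Finset.sum_congr rfl fun i _ => by simp only [hh]; ring
    rw [this]; ring
  have e2 : ∫ y, ∑ i, ∑ j, ℓ i y (Pi.single j 1) * ℓ j y (Pi.single i 1) ∂(gP μ v) = n := by
    have : ∫ y, ∑ i, ∑ j, ℓ i y (Pi.single j 1) * ℓ j y (Pi.single i 1) ∂(gP μ v)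
        = ∫ _y, (n:ℝ) ∂(gP μ v) := by
      refine integral_congr_ae ?_
      filter_upwards [hae] with y hy
      simp_rw [hl_single]
      change Matrix.trace ((1 - (2:ℝ) • Q y : Matrix (Fin n) (Fin n) ℝ) * (1 - (2:ℝ) • Q y : Matrix (Fin n) (Fin n) ℝ)) = _
      have : (1 - (2:ℝ) • Q y : Matrix (Fin n) (Fin n) ℝ) * (1 - (2:ℝ) • Q y : Matrix (Fin n) (Fin n) ℝ) = 1 := by
        have := (hQ y hy).1
        simp only [two_smul, mul_sub, sub_mul, mul_add, add_mul, mul_one, one_mul, this]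
        abel
      rw [this]; simp
    rw [this]; simp
  have e3 : ∫ y, ∑ i, (h i y) ^ 2 ∂(gP μ v) ≤ 2 * n * v + 4 * ∑ j, μ j ^ 2 := by
    have isq : ∀ j : Fin n, Integrable (fun y : Fin n → ℝ => (y j) ^ 2) (gP μ v) := fun j => by
      have c := PG.coord (0 : Fin n → ℝ) j
      simpa [sq] using (c.mul c).integrable μ v
    have is := integrable_finsetSum Finset.univ fun j _ => isq j
    calc ∫ y, ∑ i, (h i y) ^ 2 ∂(gP μ v)
        ≤ ∫ y, (2 * ∑ i, (y i) ^ 2 + 2 * ∑ i, (μ i) ^ 2) ∂(gP μ v) := by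
          refine integral_mono ?_ ((is.const_mul 2).add (integrable_const _))
            fun y => f_bound hlam hf μ y
          simp_rw [sq]
          exact (PG.sum _ fun i => (lip_PG (hlip i)).mul (lip_PG (hlip i))).integrable μ v
      _ = _ := by
          rw [integral_add (is.const_mul 2) (integrable_const _), integral_const_mul,
            integral_finsetSum _ fun j _ => isq j]
          simp_rw [int_sq μ hv]
          rw [Finset.sum_add_distrib]
          simp
          ring
  rw [e1, key, e2]
  have := mul_le_mul_of_nonneg_left e3 v.coe_nonneg
  nlinarith

end LassoSure

theorem lasso_sure_reliability_bound {n p : ℕ} (hn : 1 ≤ n) (a : Fin p → Fin n → ℝ)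
    (lam : ℝ) (hlam : 0 < lam) (x0 : Fin p → ℝ) (σ : ℝ) (hσ : 0 < σ)
    (μ : Fin n → ℝ) (hμ : μ = fun j => ∑ i, x0 i * a i j)
    (P : Measure (Fin n → ℝ))
    (hP : P = Measure.pi fun j => gaussianReal (μ j) (Real.toNNReal (σ ^ 2)))
    (f : (Fin n → ℝ) → Fin n → ℝ) (hfmeas : Measurable f)
    (hf : ∀ z, ∃ x : Fin p → ℝ, IsLassoSolPi a lam z x ∧ f z = fun j => ∑ i, x i * a i j)
    (m : (Fin n → ℝ) → ℕ) (hmmeas : Measurable m)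
    (hm : ∀ z, IsLeast
      {k : ℕ | ∃ x : Fin p → ℝ, IsLassoSolPi a lam z x ∧ {i | x i ≠ 0}.ncard = k} (m z)) :
    ∫ y, (((-(n : ℝ) * σ ^ 2 + ∑ j, (f y j - y j) ^ 2 + 2 * σ ^ 2 * (m y : ℝ))
        - ∑ j, (f y j - μ j) ^ 2) / (n * σ ^ 2)) ^ 2 ∂P
      ≤ 6 / n + 4 * (∑ j, (μ j) ^ 2) / (n ^ 2 * σ ^ 2) := by
  have hs : 0 < σ ^ 2 := by positivity
  have hv : Real.toNNReal (σ ^ 2) ≠ 0 := (Real.toNNReal_pos.2 hs).ne'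
  have h := LassoSure.main_bound hlam μ hv hf hm
  rw [Real.coe_toNNReal _ hs.le] at h
  have hP' : P = LassoSure.gP μ (Real.toNNReal (σ ^ 2)) := hP
  rw [hP']
  simp_rw [div_pow]
  rw [integral_div]
  have hn0 : (0:ℝ) < n := by exact_mod_cast hn
  have hM : 0 ≤ ∑ j, μ j ^ 2 := Finset.sum_nonneg fun _ _ => sq_nonneg _
  calc _ ≤ (3 * n * (σ ^ 2) ^ 2 + 4 * σ ^ 2 * ∑ j, (μ j) ^ 2) / (n * σ ^ 2) ^ 2 :=
        div_le_div_of_nonneg_right h (by positivity)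
    _ = 3 / n + 4 * (∑ j, (μ j) ^ 2) / (n ^ 2 * σ ^ 2) := by field_simp
    _ ≤ _ := by gcongr; norm_num
end

section
/- (Counterexample, unperturbed data, small λ) Let 0 < λ < α. Then x̂ = (α − λ, 0) is the unique global minimizer of the Lasso objective F(x) = (1/2)‖y − Ax‖₂² + λ‖x‖₁ at y = (α, 0). -/
/-- The Lasso objective for the 2×2 design matrix `A` with columns `a₁ = (1, 0)` and
`a₂ = (1, 1)` (so `A x = (x₁ + x₂, x₂)`), at data `z ∈ ℝ²` and parameter `λ`:
`F_z(x) = (1/2)‖z − Ax‖₂² + λ‖x‖₁`. -/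
noncomputable def lassoObj2 (lam : ℝ) (z : ℝ × ℝ) (x : ℝ × ℝ) : ℝ :=
  (1 / 2) * ((z.1 - (x.1 + x.2)) ^ 2 + (z.2 - x.2) ^ 2) + lam * (|x.1| + |x.2|)

/-- Counterexample, unperturbed data, small `λ`. Let `0 < λ < α`.
Then `x̂ = (α − λ, 0)` is the unique global minimizer of the Lasso objective at
`y = (α, 0)`. -/
theorem counterexample_small_lambda (α lam : ℝ) (hlam : 0 < lam) (h : lam < α) :
    (∀ x : ℝ × ℝ, lassoObj2 lam (α, 0) (α - lam, 0) ≤ lassoObj2 lam (α, 0) x) ∧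
    (∀ x : ℝ × ℝ, (∀ x' : ℝ × ℝ, lassoObj2 lam (α, 0) x ≤ lassoObj2 lam (α, 0) x') →
      x = (α - lam, 0)) := by
  have key : ∀ a b : ℝ, lassoObj2 lam (α, 0) (α - lam, 0)
      + (1 / 2) * ((α - (a + b) - lam) ^ 2 + b ^ 2) ≤ lassoObj2 lam (α, 0) (a, b) := by
    intro a b
    have h1 : |α - lam| = α - lam := abs_of_pos (by linarith)
    have h2 : lam * (a + b) ≤ lam * (|a| + |b|) :=
      mul_le_mul_of_nonneg_left (add_le_add (le_abs_self a) (le_abs_self b)) hlam.le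
    simp only [lassoObj2, h1, abs_zero]
    nlinarith [h2]
  constructor
  · rintro ⟨a, b⟩
    have := key a b
    nlinarith [sq_nonneg (α - (a + b) - lam), sq_nonneg b]
  · rintro ⟨a, b⟩ hx
    have h1 := key a b
    have h2 := hx (α - lam, 0)
    have hb : b = 0 := by
      have : b ^ 2 = 0 := by nlinarith [sq_nonneg (α - (a + b) - lam), sq_nonneg b]
      exact pow_eq_zero_iff (two_ne_zero) |>.mp this
    have ha : α - (a + b) - lam = 0 := by
      have : (α - (a + b) - lam) ^ 2 = 0 := by
        nlinarith [sq_nonneg (α - (a + b) - lam), sq_nonneg b]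
      exact pow_eq_zero_iff (two_ne_zero) |>.mp this
    ext
    · simp only
      linarith
    · exact hb
end

section
/- (Counterexample, perturbed data: instability of the support) Let 0 < λ < α and 0 < ε < α − λ, and set z₁ = (α, ε). Then x̂ = (α − λ − ε, ε) is the unique global minimizer of the Lasso objective F_{z₁}(x) = (1/2)‖z₁ − Ax‖₂² + λ‖x‖₁; in particular supp(x̂) = {1, 2}, which differs from the support {1} of the Lasso solution (α − λ, 0) at y = (α, 0), even though ‖z₁ − y‖₂ = ε can be made arbitrarily small. -/
/-- Counterexample, perturbed data: instability of the support.
Let `0 < λ < α` and `0 < ε < α − λ`, and set `z₁ = (α, ε)`. Then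
`x̂ = (α − λ − ε, ε)` is the unique global minimizer of the Lasso objective at `z₁`;
in particular both of its coordinates are nonzero, so `supp x̂ = {1, 2}` differs from the
support `{1}` of the Lasso solution `(α − λ, 0)` at `y = (α, 0)`, even though
`‖z₁ − y‖₂ = ε` can be made arbitrarily small. -/
theorem counterexample_perturbed (α lam ε : ℝ) (hlam : 0 < lam) (h : lam < α)
    (hε : 0 < ε) (hε' : ε < α - lam) :
    (∀ x : ℝ × ℝ, lassoObj2 lam (α, ε) (α - lam - ε, ε) ≤ lassoObj2 lam (α, ε) x) ∧
    (∀ x : ℝ × ℝ, (∀ x' : ℝ × ℝ, lassoObj2 lam (α, ε) x ≤ lassoObj2 lam (α, ε) x') →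
      x = (α - lam - ε, ε)) ∧
    (α - lam - ε ≠ 0 ∧ ε ≠ 0) := by
  have hF : lassoObj2 lam (α, ε) (α - lam - ε, ε) = lam * α - lam ^ 2 / 2 := by
    simp only [lassoObj2]
    rw [abs_of_pos hε, abs_of_pos (by linarith : 0 < α - lam - ε)]
    ring
  have key : ∀ x : ℝ × ℝ, lam * α - lam ^ 2 / 2 +
      (1 / 2) * ((x.1 + x.2 - (α - lam)) ^ 2 + (ε - x.2) ^ 2) ≤ lassoObj2 lam (α, ε) x := by
    intro x
    simp only [lassoObj2]
    have h1 := mul_le_mul_of_nonneg_left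
      (add_le_add (le_abs_self x.1) (le_abs_self x.2)) hlam.le
    linear_combination h1
  refine ⟨fun x => ?_, fun x hx => ?_, (by linarith : 0 < α - lam - ε).ne', hε.ne'⟩
  · have := key x
    rw [hF]
    nlinarith [sq_nonneg (x.1 + x.2 - (α - lam)), sq_nonneg (ε - x.2)]
  · have h1 := key x
    have h2 := hx (α - lam - ε, ε)
    rw [hF] at h2
    have h3 : (x.1 + x.2 - (α - lam)) ^ 2 = 0 := by
      nlinarith [sq_nonneg (x.1 + x.2 - (α - lam)), sq_nonneg (ε - x.2)]
    have h4 : (ε - x.2) ^ 2 = 0 := by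
      nlinarith [sq_nonneg (x.1 + x.2 - (α - lam)), sq_nonneg (ε - x.2)]
    have h5 := pow_eq_zero_iff (two_ne_zero) |>.mp h3
    have h6 := pow_eq_zero_iff (two_ne_zero) |>.mp h4
    ext
    · show x.1 = α - lam - ε
      linarith
    · show x.2 = ε
      linarith
end

section
/- (Nonexpansiveness of the Lasso fit) Fix λ > 0. For all y, z ∈ ℝⁿ and all Lasso solutions x_y at (y, λ) and x_z at (z, λ), one has ‖A x_z − A x_y‖₂ ≤ ‖z − y‖₂; in particular the Lasso fit z ↦ A x̂(z) is uniformly Lipschitz (with constant 1) on ℝⁿ. -/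
/-- The Lasso objective `F_{y,λ}(x) = (1/2)‖y − Ax‖₂² + λ‖x‖₁`, where the design
matrix `A` has columns `a i`, so `A x = ∑ i, x i • a i`. -/
noncomputable def lassoObj {n p : ℕ} (a : Fin p → EuclideanSpace ℝ (Fin n))
    (lam : ℝ) (y : EuclideanSpace ℝ (Fin n)) (x : Fin p → ℝ) : ℝ :=
  (1 / 2) * ‖y - ∑ i, x i • a i‖ ^ 2 + lam * ∑ i, |x i|

/-- A Lasso solution at `(y, λ)` is a global minimizer of the Lasso objective. -/
def IsLassoSol {n p : ℕ} (a : Fin p → EuclideanSpace ℝ (Fin n))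
    (lam : ℝ) (y : EuclideanSpace ℝ (Fin n)) (x : Fin p → ℝ) : Prop :=
  ∀ x' : Fin p → ℝ, lassoObj a lam y x ≤ lassoObj a lam y x'


/-- Variational inequality for a Lasso solution. -/
theorem lasso_variational {n p : ℕ} (a : Fin p → EuclideanSpace ℝ (Fin n))
    (lam : ℝ) (hlam : 0 < lam) (y : EuclideanSpace ℝ (Fin n)) (x x' : Fin p → ℝ)
    (hx : IsLassoSol a lam y x) :
    inner ℝ (y - ∑ i, x i • a i) ((∑ i, x' i • a i) - ∑ i, x i • a i)
      ≤ lam * (∑ i, |x' i|) - lam * ∑ i, |x i| := by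
  set r := y - ∑ i, x i • a i with hr
  set d := (∑ i, x' i • a i) - ∑ i, x i • a i with hd
  have key : ∀ t : ℝ, 0 < t → t ≤ 1 →
      inner ℝ r d - (lam * (∑ i, |x' i|) - lam * ∑ i, |x i|) ≤ t * (‖d‖ ^ 2 / 2) := by
    intro t ht ht1
    have h := hx (fun i => x i + t * (x' i - x i))
    unfold lassoObj at h
    have e : y - ∑ i, (x i + t * (x' i - x i)) • a i = r - t • d := by
      have : ∑ i, (x i + t * (x' i - x i)) • a i = (∑ i, x i • a i) + t • d := by
        rw [hd, ← Finset.sum_sub_distrib, Finset.smul_sum, ← Finset.sum_add_distrib]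
        refine Finset.sum_congr rfl fun i _ => ?_
        module
      rw [this, hr]
      abel
    beta_reduce at h
    rw [e, ← hr, norm_sub_sq_real r (t • d), inner_smul_right, norm_smul, Real.norm_of_nonneg ht.le] at h
    have l1 : ∑ i, |x i + t * (x' i - x i)| ≤ (1 - t) * (∑ i, |x i|) + t * ∑ i, |x' i| := by
      rw [Finset.mul_sum, Finset.mul_sum, ← Finset.sum_add_distrib]
      refine Finset.sum_le_sum fun i _ => ?_
      have : x i + t * (x' i - x i) = (1 - t) * x i + t * x' i := by ring
      rw [this]
      refine (abs_add_le _ _).trans ?_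
      rw [abs_mul, abs_mul, abs_of_pos ht, abs_of_nonneg (sub_nonneg.2 ht1)]
    have l2 := mul_le_mul_of_nonneg_left l1 hlam.le
    refine le_of_mul_le_mul_left ?_ ht
    nlinarith
  by_contra! hc
  set c := inner ℝ r d - (lam * (∑ i, |x' i|) - lam * ∑ i, |x i|) with hcdef
  have hcpos : 0 < c := by linarith
  set D := ‖d‖ ^ 2 / 2 with hD
  have hD0 : 0 ≤ D := by positivity
  have h := key (c / (c + D + D)) (by positivity) (by rw [div_le_one (by positivity)]; linarith)
  rw [div_mul_eq_mul_div, le_div_iff₀ (by positivity)] at h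
  nlinarith [mul_nonneg hcpos.le hD0, mul_pos hcpos hcpos]

/-- Nonexpansiveness of the Lasso fit. Fix `λ > 0`. For all data
`y, z ∈ ℝⁿ` and all Lasso solutions `x_y` at `(y, λ)` and `x_z` at `(z, λ)`,
`‖A x_z − A x_y‖₂ ≤ ‖z − y‖₂`: the Lasso fit is uniformly 1-Lipschitz on `ℝⁿ`. -/
theorem lasso_fit_nonexpansive {n p : ℕ} (a : Fin p → EuclideanSpace ℝ (Fin n))
    (lam : ℝ) (hlam : 0 < lam) (y z : EuclideanSpace ℝ (Fin n)) (xy xz : Fin p → ℝ)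
    (hy : IsLassoSol a lam y xy) (hz : IsLassoSol a lam z xz) :
    ‖(∑ i, xz i • a i) - ∑ i, xy i • a i‖ ≤ ‖z - y‖ := by
  have h1 := lasso_variational a lam hlam y xy xz hy
  have h2 := lasso_variational a lam hlam z xz xy hz
  set u := ∑ i, xy i • a i
  set v := ∑ i, xz i • a i
  have h3 : inner ℝ (y - u) (v - u) + inner ℝ (z - v) (u - v)
      = ‖v - u‖ ^ 2 - inner ℝ (z - y) (v - u) := by
    rw [← real_inner_self_eq_norm_sq, ← inner_sub_left, ← neg_sub v u, inner_neg_right,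
      ← sub_eq_add_neg, ← inner_sub_left]
    congr 1
    abel
  have h4 := real_inner_le_norm (z - y) (v - u)
  by_contra! hc
  nlinarith [norm_nonneg (z - y), norm_nonneg (v - u)]
end
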